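/- Assume f satisfies (f1), (f2), (f3) and (f4). Then for every a and b with 0 < a < b < ∞, problem (R) has at most one positive solution; that is, any two positive solutions u₁ and u₂ of (R) on [a,b] coincide on [a,b]. -/

import Mathlib

open Set Filter MeasureTheory

/-- `F(s) = ∫₀ˢ f(t) dt`. -/
noncomputable def Fint (f : ℝ → ℝ) (s : ℝ) : ℝ := ∫ t in (0:ℝ)..s, f t

/-- Condition (f1): `f` is continuous on `[0,∞)`, continuously differentiable on `(0,∞)`,
and `f' ∈ L¹(0,1)`. -/
def CondF1 (f : ℝ → ℝ) : Prop :=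
  ContinuousOn f (Ici 0) ∧ (∀ s ∈ Ioi (0:ℝ), DifferentiableAt ℝ f s) ∧
  ContinuousOn (deriv f) (Ioi 0) ∧ IntervalIntegrable (deriv f) volume 0 1

/-- Condition (f2) in the case `β > B > 0`. -/
def CondF2B (f : ℝ → ℝ) (β B : ℝ) : Prop :=
  f 0 = 0 ∧ 0 < B ∧ B < β ∧ (∀ s, B < s → 0 < f s) ∧
  (∀ s ∈ Icc (0:ℝ) B, f s ≤ 0) ∧ (∃ ε > (0:ℝ), ∀ s ∈ Ioo (0:ℝ) ε, f s < 0) ∧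
  Fint f β = 0

/-- Condition (f2): either `β = B = 0` and `f > 0` on `(0,∞)`, or `β > B > 0` with the
sign conditions and `F(β) = 0`. -/
def CondF2 (f : ℝ → ℝ) (β B : ℝ) : Prop :=
  (β = 0 ∧ B = 0 ∧ f 0 = 0 ∧ ∀ s, 0 < s → 0 < f s) ∨ CondF2B f β B

/-- Condition (f3): the derivative of `s ↦ F(s)/f(s)` is `≥ (n-2)/(2n)` for every `s > β`. -/
def CondF3 (n : ℕ) (f : ℝ → ℝ) (β : ℝ) : Prop :=
  ∀ s, β < s → ∃ d, ((n : ℝ) - 2) / (2 * (n : ℝ)) ≤ d ∧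
    HasDerivAt (fun t => Fint f t / f t) d s

/-- Condition (f4): superlinearity `f(s) ≤ f'(s)(s - B)` for `s > B`, with
`f(s) ≢ f'(s)(s - B)` on `[B, β]`. -/
def CondF4 (f : ℝ → ℝ) (β B : ℝ) : Prop :=
  (∀ s, B < s → f s ≤ deriv f s * (s - B)) ∧
  ¬ (∀ s ∈ Icc B β, f s = deriv f s * (s - B))

/-- A positive solution of problem (R) on the annulus `a < |x| < b`:
`u` is continuous on `[a,b]`, differentiable up to the boundary with derivative `u'`
(one-sided at the endpoints), `u'` is continuous on `[a,b]`, `u` is twice continuously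
differentiable on `(a,b)` where it satisfies `u'' + ((n-1)/r) u' + f(u) = 0`,
`u(a) = u(b) = 0` and `u > 0` on `(a,b)`. -/
def IsPosSolAnn (n : ℕ) (a b : ℝ) (f u u' : ℝ → ℝ) : Prop :=
  ContinuousOn u (Icc a b) ∧
  (∀ r ∈ Icc a b, HasDerivWithinAt u (u' r) (Icc a b) r) ∧
  ContinuousOn u' (Icc a b) ∧
  (∀ r ∈ Ioo a b, HasDerivAt u (u' r) r) ∧
  (∀ r ∈ Ioo a b, HasDerivAt u' (-(((n : ℝ) - 1) / r * u' r + f (u r))) r) ∧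
  u a = 0 ∧ u b = 0 ∧ (∀ r ∈ Ioo a b, 0 < u r)

/-- A positive solution of the exterior problem (R) with `b = ∞`:
`u` is continuous on `[a,∞)`, differentiable on `[a,∞)` with derivative `u'`
(one-sided at `a`), twice continuously differentiable on `(a,∞)` where it satisfies
`u'' + ((n-1)/r) u' + f(u) = 0`, `u(a) = 0`, `u > 0` on `(a,∞)` and `u(r) → 0` as `r → ∞`. -/
def IsPosSolExt (n : ℕ) (a : ℝ) (f u u' : ℝ → ℝ) : Prop :=
  ContinuousOn u (Ici a) ∧
  (∀ r ∈ Ici a, HasDerivWithinAt u (u' r) (Ici a) r) ∧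
  (∀ r ∈ Ioi a, HasDerivAt u (u' r) r) ∧
  (∀ r ∈ Ioi a, HasDerivAt u' (-(((n : ℝ) - 1) / r * u' r + f (u r))) r) ∧
  u a = 0 ∧ (∀ r ∈ Ioi a, 0 < u r) ∧
  Tendsto u atTop (nhds 0)

/-- The Erbe–Tang functional
`P(s) = -2n (F(s)/f(s)) ρ(s)^{n-1} u'(ρ(s)) - ρ(s)^n (u'(ρ(s)))² - 2 ρ(s)^n F(s)`,
where `ρ` is an inverse branch of the solution `u` with derivative `u'`. -/
noncomputable def Pfun (n : ℕ) (f : ℝ → ℝ) (ρ u' : ℝ → ℝ) (s : ℝ) : ℝ :=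
  -2 * (n : ℝ) * (Fint f s / f s) * (ρ s) ^ (n - 1) * u' (ρ s)
    - (ρ s) ^ n * (u' (ρ s)) ^ 2 - 2 * (ρ s) ^ n * Fint f s


namespace Ann

/-! ### Elementary calculus lemmas -/

lemma mono_of {g g' : ℝ → ℝ} {x y : ℝ} (hxy : x ≤ y) (hc : ContinuousOn g (Icc x y))
    (hd : ∀ s ∈ Ioo x y, HasDerivAt g (g' s) s) (h : ∀ s ∈ Ioo x y, 0 ≤ g' s) : g x ≤ g y := by
  have hm : MonotoneOn g (Icc x y) := by
    apply monotoneOn_of_deriv_nonneg (convex_Icc x y) hc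
    · intro s hs
      rw [interior_Icc] at hs
      exact (hd s hs).differentiableAt.differentiableWithinAt
    · intro s hs
      rw [interior_Icc] at hs
      rw [(hd s hs).deriv]
      exact h s hs
  exact hm (left_mem_Icc.2 hxy) (right_mem_Icc.2 hxy) hxy

lemma anti_of {g g' : ℝ → ℝ} {x y : ℝ} (hxy : x ≤ y) (hc : ContinuousOn g (Icc x y))
    (hd : ∀ s ∈ Ioo x y, HasDerivAt g (g' s) s) (h : ∀ s ∈ Ioo x y, g' s ≤ 0) : g y ≤ g x := by
  have := mono_of (g := fun s => - g s) (g' := fun s => - g' s) hxy hc.neg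
    (fun s hs => (hd s hs).neg) (fun s hs => by have := h s hs; linarith)
  simpa using this

lemma smono_of {g g' : ℝ → ℝ} {x y : ℝ} (hxy : x < y) (hc : ContinuousOn g (Icc x y))
    (hd : ∀ s ∈ Ioo x y, HasDerivAt g (g' s) s) (h : ∀ s ∈ Ioo x y, 0 < g' s) : g x < g y := by
  have hm : StrictMonoOn g (Icc x y) := by
    apply strictMonoOn_of_deriv_pos (convex_Icc x y) hc
    intro s hs
    rw [interior_Icc] at hs
    rw [(hd s hs).deriv]
    exact h s hs
  exact hm (left_mem_Icc.2 hxy.le) (right_mem_Icc.2 hxy.le) hxy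

lemma santi_of {g g' : ℝ → ℝ} {x y : ℝ} (hxy : x < y) (hc : ContinuousOn g (Icc x y))
    (hd : ∀ s ∈ Ioo x y, HasDerivAt g (g' s) s) (h : ∀ s ∈ Ioo x y, g' s < 0) : g y < g x := by
  have := smono_of (g := fun s => - g s) (g' := fun s => - g' s) hxy hc.neg
    (fun s hs => (hd s hs).neg) (fun s hs => by have := h s hs; linarith)
  simpa using this

/-- downward continuation of a strict inequality -/
lemma neg_down {g : ℝ → ℝ} {l t : ℝ} (hc : ContinuousOn g (Icc l t)) (h0 : g t < 0)
    (step : ∀ x ∈ Ico l t, (∀ s ∈ Ioc x t, g s < 0) → g x ≠ 0) :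
    ∀ s ∈ Icc l t, g s < 0 := by
  intro x0 hx0
  by_contra hge
  push Not at hge
  let A : Set ℝ := {s | s ∈ Icc x0 t ∧ 0 ≤ g s}
  have hcx : ContinuousOn g (Icc x0 t) := hc.mono (Icc_subset_Icc_left hx0.1)
  have hAc : IsClosed A := by
    have := hcx.preimage_isClosed_of_isClosed isClosed_Icc (isClosed_Ici (a := (0:ℝ)))
    exact this
  have hAne : A.Nonempty := ⟨x0, ⟨le_rfl, hx0.2⟩, hge⟩
  have hAb : BddAbove A := ⟨t, fun s hs => hs.1.2⟩
  have hmem := hAc.csSup_mem hAne hAb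
  set x := sSup A with hx
  have hxt : x < t := by
    rcases lt_or_eq_of_le hmem.1.2 with h | h
    · exact h
    · have := hmem.2
      rw [h] at this
      linarith
  have hlt : ∀ s ∈ Ioc x t, g s < 0 := by
    intro s hs
    by_contra hcon
    push Not at hcon
    have : s ≤ x := le_csSup hAb ⟨⟨hmem.1.1.trans hs.1.le, hs.2⟩, hcon⟩
    exact absurd hs.1 (not_lt.2 this)
  have hle : g x ≤ 0 := by
    have hcw : ContinuousWithinAt g (Ioc x t) x :=
      (hcx x ⟨hmem.1.1, hmem.1.2⟩).mono (fun s hs => ⟨hmem.1.1.trans hs.1.le, hs.2⟩)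
    have hcl : x ∈ closure (Ioc x t) := by
      rw [closure_Ioc hxt.ne]
      exact ⟨le_rfl, hxt.le⟩
    have hne : (nhdsWithin x (Ioc x t)).NeBot := mem_closure_iff_nhdsWithin_neBot.1 hcl
    refine le_of_tendsto hcw ?_
    filter_upwards [self_mem_nhdsWithin] with s hs using (hlt s hs).le
  exact step x ⟨hx0.1.trans hmem.1.1, hxt⟩ hlt (le_antisymm hle hmem.2)

/-- upward continuation of a strict inequality -/
lemma neg_up {g : ℝ → ℝ} {l t : ℝ} (hc : ContinuousOn g (Icc l t)) (h0 : g l < 0)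
    (step : ∀ x ∈ Ioc l t, (∀ s ∈ Ico l x, g s < 0) → g x ≠ 0) :
    ∀ s ∈ Icc l t, g s < 0 := by
  have key := neg_down (g := fun s => g (-s)) (l := -t) (t := -l) ?_ (by simpa using h0) ?_
  · intro s hs
    simpa using key (-s) ⟨by linarith [hs.2], by linarith [hs.1]⟩
  · exact hc.comp continuousOn_neg (fun s hs => ⟨by linarith [hs.2], by linarith [hs.1]⟩)
  · intro x hx h
    apply step (-x) ⟨by linarith [hx.2], by linarith [hx.1]⟩
    intro s hs
    simpa using h (-s) ⟨by linarith [hs.2], by linarith [hs.1]⟩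

/-- at a zero with negative values to the right the derivative is nonpositive -/
lemma deriv_nonpos_of_right {g : ℝ → ℝ} {d x t : ℝ} (hxt : x < t) (hd : HasDerivAt g d x)
    (h0 : g x = 0) (h : ∀ s ∈ Ioc x t, g s < 0) : d ≤ 0 := by
  have h1 := hd.hasDerivWithinAt (s := Ioi x)
  rw [hasDerivWithinAt_iff_tendsto_slope' (by simp)] at h1
  refine le_of_tendsto h1 ?_
  filter_upwards [Ioc_mem_nhdsGT hxt] with s hs
  rw [slope_def_field, h0]
  exact div_nonpos_of_nonpos_of_nonneg (by linarith [h s hs]) (by linarith [hs.1])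

/-- Gronwall type lemma -/
lemma zero_right {X X' : ℝ → ℝ} {C x y : ℝ} (hc : ContinuousOn X (Icc x y))
    (hd : ∀ s ∈ Ioo x y, HasDerivAt X (X' s) s) (hb : ∀ s ∈ Ioo x y, X' s ≤ C * X s)
    (h0 : X x = 0) (hnn : ∀ s, 0 ≤ X s) : ∀ s ∈ Icc x y, X s = 0 := by
  intro s hs
  have := anti_of (g := fun s => X s * Real.exp (-C * s))
    (g' := fun s => X' s * Real.exp (-C * s) + X s * (Real.exp (-C * s) * (-C))) hs.1
    ((hc.mono (Icc_subset_Icc_right hs.2)).mul (by fun_prop)) ?_ ?_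
  · simp only [h0, zero_mul] at this
    have hp := Real.exp_pos (-C * s)
    have := hnn s
    nlinarith
  · intro z hz
    refine (hd z ⟨hz.1, hz.2.trans_le hs.2⟩).mul ?_
    have : HasDerivAt (fun s : ℝ => -C * s) (-C) z := by
      simpa using (hasDerivAt_id z).const_mul (-C)
    exact this.exp
  · intro z hz
    have h1 := hb z ⟨hz.1, hz.2.trans_le hs.2⟩
    have hp := Real.exp_pos (-C * z)
    have : X' z * Real.exp (-C * z) + X z * (Real.exp (-C * z) * (-C))
      = (X' z - C * X z) * Real.exp (-C * z) := by ring
    rw [this]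
    exact mul_nonpos_of_nonpos_of_nonneg (by linarith) hp.le

lemma zero_left {X X' : ℝ → ℝ} {C x y : ℝ} (hc : ContinuousOn X (Icc x y))
    (hd : ∀ s ∈ Ioo x y, HasDerivAt X (X' s) s) (hb : ∀ s ∈ Ioo x y, -(C * X s) ≤ X' s)
    (h0 : X y = 0) (hnn : ∀ s, 0 ≤ X s) : ∀ s ∈ Icc x y, X s = 0 := by
  have key := zero_right (X := fun s => X (-s)) (X' := fun s => - X' (-s)) (C := C)
    (x := -y) (y := -x) ?_ ?_ ?_ (by simpa using h0) (fun s => hnn _)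
  · intro s hs
    simpa using key (-s) ⟨by linarith [hs.2], by linarith [hs.1]⟩
  · exact hc.comp continuousOn_neg (fun s hs => ⟨by linarith [hs.2], by linarith [hs.1]⟩)
  · intro s hs
    have h1 := hd (-s) ⟨by linarith [hs.2], by linarith [hs.1]⟩
    have h2 := HasDerivAt.comp s h1 (hasDerivAt_neg s)
    rw [mul_neg_one] at h2
    exact h2
  · intro s hs
    have := hb (-s) ⟨by linarith [hs.2], by linarith [hs.1]⟩
    linarith


lemma inv_exists {u u' : ℝ → ℝ} {a c : ℝ} (hac : a < c) (hc : ContinuousOn u (Icc a c))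
    (hd : ∀ x ∈ Ioo a c, HasDerivAt u (u' x) x) (hpos : ∀ x ∈ Ioo a c, 0 < u' x)
    (h0 : u a = 0) : StrictMonoOn u (Icc a c) ∧ 0 < u c ∧
    ∃ r : ℝ → ℝ, ContinuousOn r (Icc 0 (u c)) ∧
      (∀ s ∈ Icc 0 (u c), r s ∈ Icc a c ∧ u (r s) = s) ∧
      (∀ x ∈ Icc a c, u x ∈ Icc 0 (u c) ∧ r (u x) = x) ∧
      (∀ s ∈ Ioo 0 (u c), r s ∈ Ioo a c ∧ HasDerivAt r (u' (r s))⁻¹ s) := by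
  have hm : StrictMonoOn u (Icc a c) := by
    apply strictMonoOn_of_deriv_pos (convex_Icc a c) hc
    intro s hs
    rw [interior_Icc] at hs
    rw [(hd s hs).deriv]
    exact hpos s hs
  have hal : a ∈ Icc a c := left_mem_Icc.2 hac.le
  have hcr : c ∈ Icc a c := right_mem_Icc.2 hac.le
  have hM : 0 < u c := by rw [← h0]; exact hm hal hcr hac
  refine ⟨hm, hM, ?_⟩
  have hex : ∀ s, ∃ x, s ∈ Icc 0 (u c) → x ∈ Icc a c ∧ u x = s := by
    intro s
    by_cases hs : s ∈ Icc 0 (u c)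
    · have := intermediate_value_Icc hac.le hc
      rw [h0] at this
      obtain ⟨x, hx, hxs⟩ := this hs
      exact ⟨x, fun _ => ⟨hx, hxs⟩⟩
    · exact ⟨0, fun h => absurd h hs⟩
  choose r hr using hex
  have hmem : ∀ x ∈ Icc a c, u x ∈ Icc 0 (u c) := by
    intro x hx
    refine ⟨?_, hm.monotoneOn hx hcr hx.2⟩
    rw [← h0]; exact hm.monotoneOn hal hx hx.1
  have hinv : ∀ x ∈ Icc a c, r (u x) = x := by
    intro x hx
    obtain ⟨h1, h2⟩ := hr (u x) (hmem x hx)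
    exact hm.injOn h1 hx h2
  have hrc : ContinuousOn r (Icc 0 (u c)) := by
    intro s0 hs0
    obtain ⟨h1, h2⟩ := hr s0 hs0
    refine tendsto_order.2 ⟨fun y hy => ?_, fun y hy => ?_⟩
    · by_cases hya : y < a
      · filter_upwards [self_mem_nhdsWithin] with s hs
        exact hya.trans_le (hr s hs).1.1
      · push Not at hya
        have hyI : y ∈ Icc a c := ⟨hya, hy.le.trans h1.2⟩
        have hlt : u y < s0 := by rw [← h2]; exact hm hyI h1 hy
        filter_upwards [self_mem_nhdsWithin, mem_nhdsWithin_of_mem_nhds (Ioi_mem_nhds hlt)]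
          with s hs hs2
        obtain ⟨h3, h4⟩ := hr s hs
        rw [← hm.lt_iff_lt hyI h3, h4]
        exact hs2
    · by_cases hya : c < y
      · filter_upwards [self_mem_nhdsWithin] with s hs
        exact (hr s hs).1.2.trans_lt hya
      · push Not at hya
        have hyI : y ∈ Icc a c := ⟨h1.1.trans hy.le, hya⟩
        have hlt : s0 < u y := by rw [← h2]; exact hm h1 hyI hy
        filter_upwards [self_mem_nhdsWithin, mem_nhdsWithin_of_mem_nhds (Iio_mem_nhds hlt)]
          with s hs hs2
        obtain ⟨h3, h4⟩ := hr s hs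
        rw [← hm.lt_iff_lt h3 hyI, h4]
        exact hs2
  refine ⟨r, hrc, hr, fun x hx => ⟨hmem x hx, hinv x hx⟩, ?_⟩
  intro s hs
  obtain ⟨h1, h2⟩ := hr s ⟨hs.1.le, hs.2.le⟩
  have hI : r s ∈ Ioo a c := by
    refine ⟨lt_of_le_of_ne h1.1 ?_, lt_of_le_of_ne h1.2 ?_⟩
    · intro h
      rw [← h, h0] at h2
      exact hs.1.ne h2
    · intro h
      rw [h] at h2
      exact hs.2.ne h2.symm
  refine ⟨hI, ?_⟩
  apply HasDerivAt.of_local_left_inverse (hrc.continuousAt (Icc_mem_nhds hs.1 hs.2)) (hd _ hI)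
    (hpos _ hI).ne'
  filter_upwards [Icc_mem_nhds hs.1 hs.2] with y hy
  exact (hr y hy).2

/-- Facts about the nonlinearity used in the proof. -/
structure FD (k : ℕ) (f : ℝ → ℝ) (β B : ℝ) : Prop where
  cont : ContinuousOn f (Ici 0)
  diff : ∀ s, 0 < s → DifferentiableAt ℝ f s
  dcont : ContinuousOn (deriv f) (Ioi 0)
  B_pos : 0 < B
  B_lt : B < β
  f_pos : ∀ s, B < s → 0 < f s
  f_nonpos : ∀ s ∈ Icc (0:ℝ) B, f s ≤ 0
  F_deriv : ∀ s, 0 < s → HasDerivAt (Fint f) (f s) s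
  F_cont : ContinuousOn (Fint f) (Ici 0)
  F_zero : Fint f 0 = 0
  F_beta : Fint f β = 0
  F_neg : ∀ s ∈ Ioo 0 β, Fint f s < 0
  F_pos : ∀ s, β < s → 0 < Fint f s
  f3 : ∀ s, β < s → ∃ d, (k : ℝ) ≤ 2 * (k + 2) * d ∧
    HasDerivAt (fun t => Fint f t / f t) d s
  f4 : ∀ s, B < s → f s ≤ deriv f s * (s - B)

lemma FD_of {k : ℕ} {f : ℝ → ℝ} {β B : ℝ}
    (hf1 : CondF1 f) (hf2 : CondF2 f β B) (hf3 : CondF3 (k + 2) f β) (hf4 : CondF4 f β B) :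
    FD k f β B := by
  have h2 : CondF2B f β B := by
    rcases hf2 with ⟨h1, h2, h3, -⟩ | h
    · exfalso
      apply hf4.2
      subst h1 h2
      intro s hs
      have : s = 0 := le_antisymm hs.2 hs.1
      subst this
      simp [h3]
    · exact h
  obtain ⟨hc, hd, hdc, -⟩ := hf1
  obtain ⟨h0, hB, hBb, hpos, hnp, ⟨ε, hε, hneg⟩, hFb⟩ := h2
  have hfint : ∀ s, 0 ≤ s → IntervalIntegrable f volume 0 s := by
    intro s hs
    apply ContinuousOn.intervalIntegrable
    rw [uIcc_of_le hs]
    exact hc.mono Icc_subset_Ici_self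
  have hFd : ∀ s, 0 < s → HasDerivAt (Fint f) (f s) s := by
    intro s hs
    have hca : ContinuousAt f s := hc.continuousAt (Ici_mem_nhds hs)
    apply intervalIntegral.integral_hasDerivAt_right (hfint s hs.le) _ hca
    exact (hc.mono Ioi_subset_Ici_self).stronglyMeasurableAtFilter isOpen_Ioi s hs
  have hF0 : Fint f 0 = 0 := by simp [Fint]
  have hFc : ContinuousOn (Fint f) (Ici 0) := by
    intro s hs
    have h1 : ContinuousOn (Fint f) (Icc 0 (s + 1)) := by
      have := intervalIntegral.continuousOn_primitive_interval' (μ := volume)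
        (hfint (s + 1) (by linarith [mem_Ici.1 hs])) (left_mem_uIcc)
      rw [uIcc_of_le (by linarith [mem_Ici.1 hs])] at this
      exact this
    refine (h1 s ⟨hs, by linarith⟩).mono_of_mem_nhdsWithin ?_
    have : Iic (s+1) ∈ nhds s := Iic_mem_nhds (by linarith)
    filter_upwards [self_mem_nhdsWithin, mem_nhdsWithin_of_mem_nhds this] with x hx hx2
    exact ⟨hx, hx2⟩
  have hsub : ∀ x y : ℝ, 0 ≤ x → ContinuousOn (Fint f) (Icc x y) := fun x y hx =>
    hFc.mono (fun s hs => hx.trans hs.1)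
  have hFneg1 : ∀ s, 0 < s → s ≤ B → Fint f s < 0 := by
    intro s hs hsB
    set e := min (ε / 2) s with he
    have he0 : 0 < e := lt_min (by linarith) hs
    have h1 : Fint f e < Fint f 0 := santi_of he0 (hsub _ _ le_rfl)
      (fun x hx => hFd x hx.1) (fun x hx => hneg x ⟨hx.1, by
        have := min_le_left (ε/2) s
        linarith [hx.2]⟩)
    have h2 : Fint f s ≤ Fint f e := anti_of (min_le_right _ _) (hsub _ _ he0.le)
      (fun x hx => hFd x (he0.trans hx.1)) (fun x hx => hnp x
        ⟨(he0.trans hx.1).le, (hx.2.trans_le hsB).le⟩)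
    linarith
  refine ⟨hc, hd, hdc, hB, hBb, hpos, hnp, hFd, hFc, hF0, hFb, ?_, ?_, ?_, hf4.1⟩
  · intro s hs
    by_cases hsB : s ≤ B
    · exact hFneg1 s hs.1 hsB
    · push Not at hsB
      have : Fint f s < Fint f β := smono_of hs.2 (hsub _ _ hs.1.le)
        (fun x hx => hFd x (hs.1.trans hx.1)) (fun x hx => hpos x (hsB.trans hx.1))
      linarith
  · intro s hs
    have hb0 : 0 < β := hB.trans hBb
    have : Fint f β < Fint f s := smono_of hs (hsub _ _ hb0.le)
        (fun x hx => hFd x (hb0.trans hx.1)) (fun x hx => hpos x (hBb.trans hx.1))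
    linarith
  · intro s hs
    obtain ⟨d, hd1, hd2⟩ := hf3 s hs
    refine ⟨d, ?_, hd2⟩
    push_cast at hd1
    have hk : (0:ℝ) < 2 * (k + 2) := by positivity
    rw [div_le_iff₀ hk] at hd1
    linarith

lemma pos_left {v v' : ℝ → ℝ} {l c : ℝ}
    (hd : ∀ x ∈ Ioc l c, HasDerivAt v (v' x) x) (hz : ∀ x ∈ Ioc l c, v x = 0 → v' x < 0)
    (hc : v c = 0) : ∀ x ∈ Ioo l c, 0 < v x := by
  intro x hx
  have hlc : l < c := hx.1.trans hx.2
  have hcm : c ∈ Ioc l c := right_mem_Ioc.2 hlc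
  have h1 := (hd c hcm).hasDerivWithinAt (s := Iio c)
  rw [hasDerivWithinAt_iff_tendsto_slope' (by simp)] at h1
  have h2 := h1.eventually (Iio_mem_nhds (hz c hcm hc))
  obtain ⟨t, ht, htx⟩ := (h2.and (Ioo_mem_nhdsLT hx.2)).exists
  have hvt : 0 < v t := by
    have ht' : slope v c t < 0 := ht
    rw [slope_def_field, hc, sub_zero] at ht'
    by_contra hcon
    push Not at hcon
    have := div_nonneg_of_nonpos hcon (show t - c ≤ 0 by linarith [htx.2])
    linarith
  have := neg_down (g := fun s => - v s) (l := x) (t := t) ?_ (by simpa using hvt) ?_ x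
    ⟨le_rfl, htx.1.le⟩
  · simpa using this
  · intro s hs
    exact (hd s ⟨hx.1.trans_le hs.1, hs.2.trans htx.2.le⟩).continuousAt.continuousWithinAt.neg
  · intro y hy hneg h0
    have hym : y ∈ Ioc l c := ⟨hx.1.trans_le hy.1, hy.2.le.trans htx.2.le⟩
    have := deriv_nonpos_of_right hy.2 (hd y hym).neg h0 hneg
    have := hz y hym (by simpa using h0)
    linarith

/-- The two inverse branches of a solution. -/
structure Br (k : ℕ) (a b β : ℝ) (f u u' : ℝ → ℝ) (c M : ℝ) (r p R m : ℝ → ℝ) : Prop where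
  hM : β < M
  hc : c ∈ Ioo a b
  r_cont : ContinuousOn r (Icc 0 M)
  p_cont : ContinuousOn p (Icc 0 M)
  R_cont : ContinuousOn R (Icc 0 M)
  m_cont : ContinuousOn m (Icc 0 M)
  r0 : r 0 = a
  rM : r M = c
  R0 : R 0 = b
  RM : R M = c
  pM : p M = 0
  mM : m M = 0
  p_pos : ∀ s ∈ Ico 0 M, 0 < p s
  m_pos : ∀ s ∈ Ioo 0 M, 0 < m s
  r_pos : ∀ s ∈ Icc 0 M, 0 < r s
  R_pos : ∀ s ∈ Icc 0 M, 0 < R s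
  r_deriv : ∀ s ∈ Ioo 0 M, HasDerivAt r (1 / p s) s
  p_deriv : ∀ s ∈ Ioo 0 M, HasDerivAt p (-((k + 1) / r s) - f s / p s) s
  R_deriv : ∀ s ∈ Ioo 0 M, HasDerivAt R (-(1 / m s)) s
  m_deriv : ∀ s ∈ Ioo 0 M, HasDerivAt m ((k + 1) / R s - f s / m s) s
  energy : ∀ s ∈ Ioo 0 M, 0 < m s ^ 2 + 2 * Fint f s
  r_mem : ∀ s ∈ Icc 0 M, r s ∈ Icc a c
  R_mem : ∀ s ∈ Icc 0 M, R s ∈ Icc c b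
  r_memo : ∀ s ∈ Ioo 0 M, r s ∈ Ioo a c
  R_memo : ∀ s ∈ Ioo 0 M, R s ∈ Ioo c b
  u_r : ∀ s ∈ Icc 0 M, u (r s) = s
  u_R : ∀ s ∈ Icc 0 M, u (R s) = s
  u'_r : ∀ s ∈ Icc 0 M, u' (r s) = p s
  u'_R : ∀ s ∈ Icc 0 M, u' (R s) = - m s
  between : ∀ s ∈ Icc 0 M, ∀ x, r s < x → x < R s → s < u x
  cover_r : ∀ x ∈ Icc a c, u x ∈ Icc 0 M ∧ r (u x) = x
  cover_R : ∀ x ∈ Icc c b, u x ∈ Icc 0 M ∧ R (u x) = x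

lemma exists_br {k : ℕ} {a b β B : ℝ} {f u u' : ℝ → ℝ} (hF : FD k f β B) (ha : 0 < a)
    (hab : a < b) (hs : IsPosSolAnn (k + 2) a b f u u') :
    ∃ c M r p R m, Br k a b β f u u' c M r p R m := by
  obtain ⟨huc, -, hu'c, hud, hu'd, hua, hub, hupos⟩ := hs
  have hu'd : ∀ r ∈ Ioo a b, HasDerivAt u' (-(((k : ℝ) + 1) / r * u' r + f (u r))) r := by
    intro r hr
    have := hu'd r hr
    have e : ((k + 2 : ℕ) : ℝ) - 1 = k + 1 := by push_cast; ring
    rwa [e] at this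
  have hunn : ∀ x ∈ Icc a b, 0 ≤ u x := by
    intro x hx
    rcases eq_or_lt_of_le hx.1 with h | h
    · rw [← h, hua]
    rcases eq_or_lt_of_le hx.2 with h' | h'
    · rw [h', hub]
    exact (hupos x ⟨h, h'⟩).le
  set E : ℝ → ℝ := fun x => u' x ^ 2 + 2 * Fint f (u x) with hE
  have hEc : ContinuousOn E (Icc a b) := by
    refine (hu'c.pow 2).add (continuousOn_const.mul (hF.F_cont.comp huc ?_))
    exact fun x hx => hunn x hx
  have hEd : ∀ x ∈ Ioo a b, HasDerivAt E (-(2 * ((k + 1) / x * u' x ^ 2))) x := by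
    intro x hx
    have h1 := (hu'd x hx).pow 2
    have h2 := ((hF.F_deriv (u x) (hupos x hx)).comp x (hud x hx)).const_mul 2
    refine (h1.add h2).congr_deriv ?_
    norm_num
    ring
  have hEmono : ∀ x ∈ Icc a b, E b ≤ E x := by
    intro x hx
    refine anti_of hx.2 (hEc.mono (Icc_subset_Icc_left hx.1))
      (fun y hy => hEd y ⟨hx.1.trans_lt hy.1, hy.2⟩) ?_
    intro y hy
    have : 0 < y := ha.trans_le (hx.1.trans hy.1.le)
    have : 0 ≤ ((k:ℝ) + 1) / y * u' y ^ 2 := by positivity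
    linarith
  have hEb : 0 ≤ E b := by
    simp only [hE, hub, hF.F_zero]
    positivity
  have hβ : 0 < β := hF.B_pos.trans hF.B_lt
  have hcrit : ∀ x ∈ Ioo a b, u' x = 0 → 0 < f (u x) := by
    intro x hx h0
    have h1 := hEmono x ⟨hx.1.le, hx.2.le⟩
    have h2 : 0 ≤ Fint f (u x) := by
      have : E x = 2 * Fint f (u x) := by simp [hE, h0]
      linarith
    apply hF.f_pos
    by_contra hcon
    push Not at hcon
    have := hF.F_neg (u x) ⟨hupos x hx, hcon.trans_lt hF.B_lt⟩
    linarith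
  -- maximum
  obtain ⟨c, hcI, hcmax⟩ := isCompact_Icc.exists_isMaxOn (nonempty_Icc.2 hab.le) huc
  have hmid : (a + b) / 2 ∈ Ioo a b := ⟨by linarith, by linarith⟩
  have huc0 : 0 < u c := (hupos _ hmid).trans_le (hcmax (Ioo_subset_Icc_self hmid))
  have hc : c ∈ Ioo a b := by
    refine ⟨lt_of_le_of_ne hcI.1 ?_, lt_of_le_of_ne hcI.2 ?_⟩
    · intro h
      rw [← h, hua] at huc0
      exact lt_irrefl _ huc0
    · intro h
      rw [h, hub] at huc0
      exact lt_irrefl _ huc0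
  have hu'c0 : u' c = 0 :=
    (hcmax.isLocalMax (Icc_mem_nhds hc.1 hc.2)).hasDerivAt_eq_zero (hud c hc)
  have hpl : ∀ x ∈ Ioo a c, 0 < u' x := by
    apply pos_left (v' := fun x => -(((k : ℝ) + 1) / x * u' x + f (u x)))
    · intro x hx
      exact hu'd x ⟨hx.1, hx.2.trans_lt hc.2⟩
    · intro x hx h0
      have := hcrit x ⟨hx.1, hx.2.trans_lt hc.2⟩ h0
      simp only [h0]
      linarith
    · exact hu'c0
  have hnr : ∀ x ∈ Ioo c b, u' x < 0 := by
    have key := pos_left (v := fun x => - u' (-x))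
      (v' := fun x => -(((k : ℝ) + 1) / (-x) * u' (-x) + f (u (-x)))) (l := -b) (c := -c) ?_ ?_ ?_
    · intro x hx
      have := key (-x) ⟨by linarith [hx.2], by linarith [hx.1]⟩
      simpa using this
    · intro x hx
      have h1 := hu'd (-x) ⟨by linarith [hx.2, hc.1], by linarith [hx.1]⟩
      have h2 := (HasDerivAt.comp x h1 (hasDerivAt_neg x)).neg
      rw [mul_neg_one, neg_neg] at h2
      exact h2
    · intro x hx h0
      have h0' : u' (-x) = 0 := by simpa using h0
      have := hcrit (-x) ⟨by linarith [hx.2, hc.1], by linarith [hx.1]⟩ h0'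
      simp only [h0']
      linarith
    · simp [hu'c0]
  have hEs1 : ∀ x ∈ Ico c b, E b < E x := by
    intro x hx
    refine santi_of hx.2 (hEc.mono (Icc_subset_Icc_left (hc.1.le.trans hx.1)))
      (fun y hy => hEd y ⟨hc.1.trans_le (hx.1.trans hy.1.le), hy.2⟩) ?_
    intro y hy
    have h1 : 0 < y := ha.trans (hc.1.trans_le (hx.1.trans hy.1.le))
    have h2 := hnr y ⟨hx.1.trans_lt hy.1, hy.2⟩
    have : 0 < ((k:ℝ) + 1) / y * u' y ^ 2 := by
      have := pow_pos (neg_pos.2 h2) 2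
      rw [neg_sq] at this
      positivity
    linarith
  have hEs2 : E c < E a := by
    refine santi_of hc.1 (hEc.mono (Icc_subset_Icc_right hc.2.le))
      (fun y hy => hEd y ⟨hy.1, hy.2.trans hc.2⟩) ?_
    intro y hy
    have h1 : 0 < y := ha.trans hy.1
    have h2 := hpl y hy
    have : 0 < ((k:ℝ) + 1) / y * u' y ^ 2 := by positivity
    linarith
  have hEc' : E c = 2 * Fint f (u c) := by simp [hE, hu'c0]
  have hFM : 0 < Fint f (u c) := by
    have := hEs1 c ⟨le_rfl, hc.2⟩
    linarith
  have hM : β < u c := by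
    by_contra hcon
    push Not at hcon
    rcases eq_or_lt_of_le hcon with h | h
    · rw [h, hF.F_beta] at hFM
      exact lt_irrefl _ hFM
    · have := hF.F_neg (u c) ⟨huc0, h⟩
      linarith
  have hu'a : 0 < u' a := by
    have h1 : 0 ≤ u' a := by
      have hcw : ContinuousWithinAt u' (Ioo a c) a :=
        (hu'c a ⟨le_rfl, hab.le⟩).mono (fun s hs => ⟨hs.1.le, (hs.2.trans hc.2).le⟩)
      have hcl : a ∈ closure (Ioo a c) := by
        rw [closure_Ioo hc.1.ne]
        exact ⟨le_rfl, hc.1.le⟩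
      have hne : (nhdsWithin a (Ioo a c)).NeBot := mem_closure_iff_nhdsWithin_neBot.1 hcl
      refine ge_of_tendsto hcw ?_
      filter_upwards [self_mem_nhdsWithin] with s hs using (hpl s hs).le
    have h2 : E a = u' a ^ 2 := by simp [hE, hua, hF.F_zero]
    rcases eq_or_lt_of_le h1 with h | h
    · rw [← h] at h2
      norm_num at h2
      linarith
    · exact h
  -- increasing branch
  obtain ⟨hsm, -, r, hrc, hr1, hr2, hr3⟩ := inv_exists hc.1
    (huc.mono (Icc_subset_Icc_right hc.2.le)) (fun x hx => hud x ⟨hx.1, hx.2.trans hc.2⟩)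
    hpl hua
  -- decreasing branch
  have hmaps : MapsTo (fun x : ℝ => -x) (Icc (-b) (-c)) (Icc a b) :=
    fun s hs => ⟨by linarith [hs.2, hc.1], by linarith [hs.1]⟩
  obtain ⟨hsm2, -, q, hqc, hq1, hq2, hq3⟩ := inv_exists (u := fun x => u (-x))
    (u' := fun x => - u' (-x)) (a := -b) (c := -c) (by linarith [hc.2])
    (huc.comp continuousOn_neg hmaps)
    (fun x hx => by
      have h1 := hud (-x) ⟨by linarith [hx.2, hc.1], by linarith [hx.1]⟩
      have h2 := (HasDerivAt.comp x h1 (hasDerivAt_neg x))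
      rw [mul_neg_one] at h2
      exact h2)
    (fun x hx => by
      have := hnr (-x) ⟨by linarith [hx.2], by linarith [hx.1]⟩
      simpa using this)
    (by simpa using hub)
  simp only [neg_neg] at hqc hq1 hq2 hq3
  have hM0 : (0:ℝ) ∈ Icc 0 (u c) := ⟨le_rfl, huc0.le⟩
  have hMM : u c ∈ Icc 0 (u c) := ⟨huc0.le, le_rfl⟩
  have hRmem : ∀ s ∈ Icc 0 (u c), -q s ∈ Icc c b := by
    intro s hs
    have := (hq1 s hs).1
    exact ⟨by linarith [this.2], by linarith [this.1]⟩
  have hRmemo : ∀ s ∈ Ioo 0 (u c), -q s ∈ Ioo c b := by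
    intro s hs
    have := (hq3 s hs).1
    exact ⟨by linarith [this.2], by linarith [this.1]⟩
  have hra : r 0 = a := by
    have := (hr2 a ⟨le_rfl, hc.1.le⟩).2
    rwa [hua] at this
  have hrM : r (u c) = c := (hr2 c ⟨hc.1.le, le_rfl⟩).2
  have hqb : q 0 = -b := by
    have := (hq2 (-b) ⟨le_rfl, by linarith [hc.2]⟩).2
    rwa [neg_neg, hub] at this
  have hqM : q (u c) = -c := by
    have := (hq2 (-c) ⟨by linarith [hc.2], le_rfl⟩).2
    rwa [neg_neg] at this
  have hRc : ContinuousOn (fun s => - q s) (Icc 0 (u c)) := hqc.neg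
  refine ⟨c, u c, r, fun s => u' (r s), fun s => - q s, fun s => - u' (- q s), ?_⟩
  refine
   { hM := hM
     hc := hc
     r_cont := hrc
     p_cont := hu'c.comp hrc (fun s hs => ⟨(hr1 s hs).1.1, (hr1 s hs).1.2.trans hc.2.le⟩)
     R_cont := hRc
     m_cont := (hu'c.comp hRc (fun s hs => ⟨hc.1.le.trans (hRmem s hs).1, (hRmem s hs).2⟩)).neg
     r0 := hra
     rM := hrM
     R0 := by simp [hqb]
     RM := by simp [hqM]
     pM := by simp [hrM, hu'c0]
     mM := by simp [hqM, hu'c0]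
     p_pos := ?_
     m_pos := fun s hs => by
       have := hnr _ (hRmemo s hs)
       simpa using this
     r_pos := fun s hs => ha.trans_le (hr1 s hs).1.1
     R_pos := fun s hs => ha.trans_le (hc.1.le.trans (hRmem s hs).1)
     r_deriv := fun s hs => by
       rw [one_div]
       exact (hr3 s hs).2
     p_deriv := ?_
     R_deriv := ?_
     m_deriv := ?_
     energy := ?_
     r_mem := fun s hs => (hr1 s hs).1
     R_mem := hRmem
     r_memo := fun s hs => (hr3 s hs).1
     R_memo := hRmemo
     u_r := fun s hs => (hr1 s hs).2
     u_R := fun s hs => (hq1 s hs).2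
     u'_r := fun s hs => rfl
     u'_R := fun s hs => by simp
     between := ?_
     cover_r := hr2
     cover_R := ?_ }
  · intro s hs
    rcases eq_or_lt_of_le hs.1 with h | h
    · simpa [← h, hra] using hu'a
    · exact hpl _ (hr3 s ⟨h, hs.2⟩).1
  · intro s hs
    obtain ⟨h1, h2⟩ := hr3 s hs
    have h3 := HasDerivAt.comp s (hu'd (r s) ⟨h1.1, h1.2.trans hc.2⟩) h2
    refine h3.congr_deriv ?_
    have h4 := (hpl _ h1).ne'
    rw [(hr1 s ⟨hs.1.le, hs.2.le⟩).2]
    field_simp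
    ring
  · intro s hs
    refine (hq3 s hs).2.neg.congr_deriv ?_
    rw [one_div]
  · intro s hs
    have h1 := hRmemo s hs
    have h2 := (hq3 s hs).2.neg
    have h3 := (HasDerivAt.comp s (hu'd (- q s) ⟨hc.1.trans h1.1, h1.2⟩) h2).neg
    refine h3.congr_deriv ?_
    have h4 := (hnr _ h1).ne
    rw [(hq1 s ⟨hs.1.le, hs.2.le⟩).2]
    have h5 : q s ≠ 0 := by
      have := ha.trans (hc.1.trans h1.1)
      intro h
      rw [h] at this
      simp at this
    field_simp
    ring
  · intro s hs
    have h1 := hRmemo s hs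
    have := hEs1 _ ⟨h1.1.le, h1.2⟩
    have e : E (- q s) = u' (- q s) ^ 2 + 2 * Fint f s := by
      simp only [hE]
      rw [(hq1 s ⟨hs.1.le, hs.2.le⟩).2]
    simp only [neg_sq]
    linarith
  · intro s hs x hx1 hx2
    obtain ⟨h1, h2⟩ := hr1 s hs
    obtain ⟨h3, h4⟩ := hq1 s hs
    by_cases hxc : x ≤ c
    · rw [← h2]
      exact hsm h1 ⟨h1.1.trans hx1.le, hxc⟩ hx1
    · push Not at hxc
      have := hsm2 h3 (b := -x) ⟨by linarith [h3.1], by linarith⟩ (by linarith)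
      simp only [neg_neg] at this
      linarith
  · intro x hx
    have := hq2 (-x) ⟨by linarith [hx.2], by linarith [hx.1]⟩
    rw [neg_neg] at this
    exact ⟨this.1, by simp [this.2]⟩

lemma two_mul_abs_le (x y : ℝ) : 2 * |x * y| ≤ x ^ 2 + y ^ 2 := by
  rw [abs_mul]
  nlinarith [sq_nonneg (|x| - |y|), sq_abs x, sq_abs y]

lemma uniq_interior {k : ℕ} {a b β B : ℝ} {f u₁ u₁' u₂ u₂' : ℝ → ℝ} (hF : FD k f β B)
    (ha : 0 < a) (h₁ : IsPosSolAnn (k + 2) a b f u₁ u₁')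
    (h₂ : IsPosSolAnn (k + 2) a b f u₂ u₂') {x0 : ℝ} (hx0 : x0 ∈ Ioo a b)
    (e0 : u₁ x0 = u₂ x0) (e1 : u₁' x0 = u₂' x0) : ∀ r ∈ Icc a b, u₁ r = u₂ r := by
  obtain ⟨c1, -, c1', d1, d1', ua1, ub1, pos1⟩ := h₁
  obtain ⟨c2, -, c2', d2, d2', ua2, ub2, pos2⟩ := h₂
  intro x hx
  rcases eq_or_lt_of_le hx.1 with h | hxa
  · rw [← h, ua1, ua2]
  rcases eq_or_lt_of_le hx.2 with h | hxb
  · rw [h, ub1, ub2]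
  set l := min x x0 with hl
  set t := max x x0 with ht
  have hla : a < l := lt_min hxa hx0.1
  have htb : t < b := max_lt hxb hx0.2
  have hlt : l ≤ t := min_le_max
  have hsub : ∀ s ∈ Icc l t, s ∈ Ioo a b := fun s hs => ⟨hla.trans_le hs.1, hs.2.trans_lt htb⟩
  have hsub' : Icc l t ⊆ Icc a b := fun s hs => Ioo_subset_Icc_self (hsub s hs)
  have hl0 : 0 < l := ha.trans hla
  obtain ⟨δ, K, hδ, hδK1, hδK2⟩ : ∃ δ K : ℝ, 0 < δ ∧ (∀ s ∈ Icc l t, u₁ s ∈ Icc δ K) ∧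
      (∀ s ∈ Icc l t, u₂ s ∈ Icc δ K) := by
    have hne : (Icc l t).Nonempty := nonempty_Icc.2 hlt
    obtain ⟨y1, hy1, m1⟩ := isCompact_Icc.exists_isMinOn hne (c1.mono hsub')
    obtain ⟨y2, hy2, m2⟩ := isCompact_Icc.exists_isMinOn hne (c2.mono hsub')
    obtain ⟨z1, hz1, n1⟩ := isCompact_Icc.exists_isMaxOn hne (c1.mono hsub')
    obtain ⟨z2, hz2, n2⟩ := isCompact_Icc.exists_isMaxOn hne (c2.mono hsub')
    refine ⟨min (u₁ y1) (u₂ y2), max (u₁ z1) (u₂ z2),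
      lt_min (pos1 _ (hsub _ hy1)) (pos2 _ (hsub _ hy2)), fun s hs => ?_, fun s hs => ?_⟩
    · exact ⟨(min_le_left _ _).trans (m1 hs), (n1 hs : u₁ s ≤ u₁ z1).trans (le_max_left _ _)⟩
    · exact ⟨(min_le_right _ _).trans (m2 hs), (n2 hs : u₂ s ≤ u₂ z2).trans (le_max_right _ _)⟩
  obtain ⟨L, hL⟩ : ∃ L : ℝ, ∀ s ∈ Icc δ K, ‖deriv f s‖ ≤ L :=
    isCompact_Icc.exists_bound_of_continuousOn
      (hF.dcont.mono (fun s hs => hδ.trans_le hs.1))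
  have hLip : ∀ s ∈ Icc l t, |f (u₁ s) - f (u₂ s)| ≤ L * |u₁ s - u₂ s| := by
    intro s hs
    exact (convex_Icc δ K).norm_image_sub_le_of_norm_deriv_le
      (fun y hy => hF.diff y (hδ.trans_le hy.1)) hL (hδK2 s hs) (hδK1 s hs)
  set X : ℝ → ℝ := fun s => (u₁ s - u₂ s) ^ 2 + (u₁' s - u₂' s) ^ 2 with hX
  set X' : ℝ → ℝ := fun s => 2 * (u₁ s - u₂ s) * (u₁' s - u₂' s) +
    2 * (u₁' s - u₂' s) * (-(((k:ℝ) + 1) / s * (u₁' s - u₂' s) + (f (u₁ s) - f (u₂ s)))) with hX'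
  have hXc : ContinuousOn X (Icc l t) :=
    (((c1.sub c2).pow 2).add ((c1'.sub c2').pow 2)).mono hsub'
  have hXd : ∀ s ∈ Ioo l t, HasDerivAt X (X' s) s := by
    intro s hs
    have hs' := hsub s (Ioo_subset_Icc_self hs)
    refine ((((d1 s hs').sub (d2 s hs')).pow 2).add
      (((d1' s hs').sub (d2' s hs')).pow 2)).congr_deriv ?_
    simp only [hX', Pi.sub_apply]
    push_cast
    ring
  have hXb : ∀ s ∈ Ioo l t, |X' s| ≤ (1 + 2 * ((k + 1) / l) + L) * X s := by
    intro s hs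
    have hsI := Ioo_subset_Icc_self hs
    have h1 := hLip s hsI
    have hs0 : 0 < s := hl0.trans hs.1
    have h2 : ((k:ℝ) + 1) / s ≤ (k + 1) / l :=
      div_le_div_of_nonneg_left (by positivity) hl0 hs.1.le
    have h20 : 0 ≤ ((k:ℝ) + 1) / s := by positivity
    simp only [hX, hX']
    set e := u₁ s - u₂ s
    set e' := u₁' s - u₂' s
    set g := f (u₁ s) - f (u₂ s)
    set κ := ((k:ℝ) + 1) / s
    set κ' := ((k:ℝ) + 1) / l
    have h3 := two_mul_abs_le e e'
    have hL0 : 0 ≤ L := (norm_nonneg _).trans (hL _ (hδK1 s hsI))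
    have h4 : 2 * |e' * g| ≤ L * (e ^ 2 + e' ^ 2) := by
      rw [abs_mul] at *
      have : |e'| * |g| ≤ |e'| * (L * |e|) := mul_le_mul_of_nonneg_left h1 (abs_nonneg _)
      nlinarith
    have h5 : |2 * e * e' + 2 * e' * (-(κ * e' + g))| ≤
        2 * |e * e'| + (2 * κ * e' ^ 2 + 2 * |e' * g|) := by
      have e6 : 2 * e * e' + 2 * e' * (-(κ * e' + g)) = 2 * (e * e') - (2 * κ * e' ^ 2) -
        2 * (e' * g) := by ring
      have p1 := abs_le.1 (le_refl |e * e'|)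
      have p2 := abs_le.1 (le_refl |e' * g|)
      have p3 : 0 ≤ 2 * κ * e' ^ 2 := by positivity
      rw [e6, abs_le]
      constructor <;> linarith [p1.1, p1.2, p2.1, p2.2]
    have h6 : 2 * κ * e' ^ 2 ≤ 2 * κ' * (e ^ 2 + e' ^ 2) := by
      have q1 : κ * e' ^ 2 ≤ κ' * e' ^ 2 := mul_le_mul_of_nonneg_right h2 (sq_nonneg _)
      have q2 : 0 ≤ κ' * e ^ 2 := mul_nonneg (h20.trans h2) (sq_nonneg _)
      linarith
    linarith
  have hX0 : X x0 = 0 := by simp [hX, e0, e1]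
  have hXnn : ∀ s, 0 ≤ X s := fun s => by simp only [hX]; positivity
  have hfin : X x = 0 := by
    rcases le_total x x0 with h | h
    · have hl' : l = x := min_eq_left h
      have ht' : t = x0 := max_eq_right h
      rw [hl', ht'] at hXc hXd hXb
      exact zero_left hXc hXd (fun s hs => (abs_le.1 (hXb s hs)).1) hX0 hXnn x ⟨le_rfl, h⟩
    · have hl' : l = x0 := min_eq_right h
      have ht' : t = x := max_eq_left h
      rw [hl', ht'] at hXc hXd hXb
      exact zero_right hXc hXd (fun s hs => (abs_le.1 (hXb s hs)).2) hX0 hXnn x ⟨h, le_rfl⟩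
  simp only [hX] at hfin
  nlinarith [sq_nonneg (u₁ x - u₂ x), sq_nonneg (u₁' x - u₂' x)]

lemma uniq_start {k : ℕ} {a b β B : ℝ} {f u₁ u₁' u₂ u₂' : ℝ → ℝ} (hF : FD k f β B)
    (ha : 0 < a) {c₁ M₁ c₂ M₂ : ℝ} {r₁ p₁ R₁ m₁ r₂ p₂ R₂ m₂ : ℝ → ℝ}
    (h₁ : Br k a b β f u₁ u₁' c₁ M₁ r₁ p₁ R₁ m₁)
    (h₂ : Br k a b β f u₂ u₂' c₂ M₂ r₂ p₂ R₂ m₂) (hp : p₁ 0 = p₂ 0) :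
    r₁ β = r₂ β ∧ p₁ β = p₂ β := by
  have hβ : 0 < β := hF.B_pos.trans hF.B_lt
  have hs1 : Icc 0 β ⊆ Icc 0 M₁ := Icc_subset_Icc_right h₁.hM.le
  have hs2 : Icc 0 β ⊆ Icc 0 M₂ := Icc_subset_Icc_right h₂.hM.le
  obtain ⟨δ, hδ, hδ1, hδ2⟩ : ∃ δ : ℝ, 0 < δ ∧ (∀ s ∈ Icc 0 β, δ ≤ p₁ s) ∧
      (∀ s ∈ Icc 0 β, δ ≤ p₂ s) := by
    have hne : (Icc 0 β).Nonempty := nonempty_Icc.2 hβ.le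
    obtain ⟨y1, hy1, m1⟩ := isCompact_Icc.exists_isMinOn hne (h₁.p_cont.mono hs1)
    obtain ⟨y2, hy2, m2⟩ := isCompact_Icc.exists_isMinOn hne (h₂.p_cont.mono hs2)
    refine ⟨min (p₁ y1) (p₂ y2), lt_min (h₁.p_pos _ ⟨hy1.1, hy1.2.trans_lt h₁.hM⟩)
      (h₂.p_pos _ ⟨hy2.1, hy2.2.trans_lt h₂.hM⟩), fun s hs => ?_, fun s hs => ?_⟩
    · exact (min_le_left _ _).trans (m1 hs)
    · exact (min_le_right _ _).trans (m2 hs)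
  obtain ⟨K, hK⟩ : ∃ K : ℝ, ∀ s ∈ Icc 0 β, ‖f s‖ ≤ K :=
    isCompact_Icc.exists_bound_of_continuousOn (hF.cont.mono Icc_subset_Ici_self)
  set X : ℝ → ℝ := fun s => (r₁ s - r₂ s) ^ 2 + (p₁ s - p₂ s) ^ 2 with hX
  have hXz := zero_right (X := X) (X' := fun s => 2 * (r₁ s - r₂ s) * (1 / p₁ s - 1 / p₂ s) +
    2 * (p₁ s - p₂ s) * ((-((k + 1) / r₁ s) - f s / p₁ s) - (-((k + 1) / r₂ s) - f s / p₂ s)))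
    (C := 1 / δ ^ 2 + (k + 1) / a ^ 2 + 2 * K / δ ^ 2) (x := 0) (y := β) ?_ ?_ ?_ ?_ ?_ β
    ⟨hβ.le, le_rfl⟩
  · simp only [hX] at hXz
    constructor <;> nlinarith [sq_nonneg (r₁ β - r₂ β), sq_nonneg (p₁ β - p₂ β)]
  · exact (((h₁.r_cont.mono hs1).sub (h₂.r_cont.mono hs2)).pow 2).add
      (((h₁.p_cont.mono hs1).sub (h₂.p_cont.mono hs2)).pow 2)
  · intro s hs
    have i1 : s ∈ Ioo 0 M₁ := ⟨hs.1, hs.2.trans h₁.hM⟩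
    have i2 : s ∈ Ioo 0 M₂ := ⟨hs.1, hs.2.trans h₂.hM⟩
    refine ((((h₁.r_deriv s i1).sub (h₂.r_deriv s i2)).pow 2).add
      (((h₁.p_deriv s i1).sub (h₂.p_deriv s i2)).pow 2)).congr_deriv ?_
    simp only [Pi.sub_apply]
    push_cast
    ring
  · intro s hs
    have hsI := Ioo_subset_Icc_self hs
    have q1 := hδ1 s hsI
    have q2 := hδ2 s hsI
    have a1 := (h₁.r_mem s (hs1 hsI)).1
    have a2 := (h₂.r_mem s (hs2 hsI)).1
    have hf := hK s hsI
    rw [Real.norm_eq_abs] at hf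
    simp only [hX]
    set d := r₁ s - r₂ s with hd
    set e := p₁ s - p₂ s with he
    have hp1 : 0 < p₁ s := hδ.trans_le q1
    have hp2 : 0 < p₂ s := hδ.trans_le q2
    have hr1 : 0 < r₁ s := ha.trans_le a1
    have hr2 : 0 < r₂ s := ha.trans_le a2
    set P := 1 / (p₁ s * p₂ s) with hP
    set Q := 1 / (r₁ s * r₂ s) with hQ
    have hP0 : 0 ≤ P := by positivity
    have hQ0 : 0 ≤ Q := by positivity
    have hPd : P ≤ 1 / δ ^ 2 := by
      apply one_div_le_one_div_of_le (by positivity)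
      nlinarith
    have hQd : Q ≤ 1 / a ^ 2 := by
      apply one_div_le_one_div_of_le (by positivity)
      nlinarith
    have e1 : 2 * d * (1 / p₁ s - 1 / p₂ s) + 2 * e * ((-((k + 1) / r₁ s) - f s / p₁ s)
        - (-((k + 1) / r₂ s) - f s / p₂ s)) =
        -(2 * (d * e)) * P + (k + 1) * (2 * (d * e)) * Q + 2 * (f s) * e ^ 2 * P := by
      simp only [hd, he, hP, hQ]
      field_simp
      ring
    rw [e1]
    have h3 := two_mul_abs_le d e
    have n1 := neg_abs_le (d * e)
    have n2 := le_abs_self (d * e)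
    have Y0 : 0 ≤ d ^ 2 + e ^ 2 := by positivity
    have t1 : -(2 * (d * e)) * P ≤ (d ^ 2 + e ^ 2) * (1 / δ ^ 2) :=
      mul_le_mul (by linarith) hPd hP0 Y0
    have t2 : (k + 1) * (2 * (d * e)) * Q ≤ (k + 1) * (d ^ 2 + e ^ 2) * (1 / a ^ 2) := by
      apply mul_le_mul _ hQd hQ0 (by positivity)
      apply mul_le_mul_of_nonneg_left _ (by positivity)
      linarith
    have hK0 : 0 ≤ K := (abs_nonneg _).trans hf
    have t3 : 2 * (f s) * e ^ 2 * P ≤ 2 * K * (d ^ 2 + e ^ 2) * (1 / δ ^ 2) := by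
      apply mul_le_mul _ hPd hP0 (by positivity)
      have := le_abs_self (f s)
      have u1 : f s * e ^ 2 ≤ K * e ^ 2 := mul_le_mul_of_nonneg_right (by linarith) (sq_nonneg _)
      have u2 : 0 ≤ K * d ^ 2 := by positivity
      linarith
    have e2 : (1 / δ ^ 2 + (k + 1) / a ^ 2 + 2 * K / δ ^ 2) * (d ^ 2 + e ^ 2) =
      (d ^ 2 + e ^ 2) * (1 / δ ^ 2) + (k + 1) * (d ^ 2 + e ^ 2) * (1 / a ^ 2) +
      2 * K * (d ^ 2 + e ^ 2) * (1 / δ ^ 2) := by ring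
    rw [e2]
    linarith
  · simp [hX, h₁.r0, h₂.r0, hp]
  · intro s
    simp only [hX]
    positivity

/-! ### Derivative computations along a branch -/

lemma w_deriv {k : ℕ} {f R m : ℝ → ℝ} {s : ℝ} (hR : HasDerivAt R (-(1 / m s)) s)
    (hm : HasDerivAt m ((k + 1) / R s - f s / m s) s) (R0 : R s ≠ 0) (m0 : m s ≠ 0) :
    HasDerivAt (fun t => R t ^ (k + 1) * m t) (-(R s ^ (k + 1) * f s / m s)) s := by
  have h := (hR.pow (k + 1)).mul hm
  refine h.congr_deriv ?_
  simp only [Pi.pow_apply, Nat.add_sub_cancel]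
  push_cast
  field_simp
  ring

lemma wsq_deriv {k : ℕ} {f R m : ℝ → ℝ} {s : ℝ} (hR : HasDerivAt R (-(1 / m s)) s)
    (hm : HasDerivAt m ((k + 1) / R s - f s / m s) s) (R0 : R s ≠ 0) (m0 : m s ≠ 0) :
    HasDerivAt (fun t => (R t ^ (k + 1) * m t) ^ 2) (-(2 * (R s ^ (k + 1)) ^ 2 * f s)) s := by
  have h := (w_deriv hR hm R0 m0).pow 2
  refine h.congr_deriv ?_
  push_cast
  field_simp

lemma E_deriv {k : ℕ} {f R m : ℝ → ℝ} {s : ℝ}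
    (hF : HasDerivAt (Fint f) (f s) s)
    (hm : HasDerivAt m ((k + 1) / R s - f s / m s) s) (R0 : R s ≠ 0) (m0 : m s ≠ 0) :
    HasDerivAt (fun t => m t ^ 2 + 2 * Fint f t) (2 * (k + 1) * m s / R s) s := by
  have h := (hm.pow 2).add (hF.const_mul 2)
  refine h.congr_deriv ?_
  push_cast
  field_simp
  ring

lemma Z_deriv {k : ℕ} {f R m : ℝ → ℝ} {s : ℝ} (hR : HasDerivAt R (-(1 / m s)) s)
    (hF : HasDerivAt (Fint f) (f s) s)
    (hm : HasDerivAt m ((k + 1) / R s - f s / m s) s) (R0 : R s ≠ 0) (m0 : m s ≠ 0) :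
    HasDerivAt (fun t => R t ^ (2 * k + 2) * (m t ^ 2 + 2 * Fint f t))
      (-(4 * (k + 1) * R s ^ (2 * k + 1) * Fint f s / m s)) s := by
  have h := (hR.pow (2 * k + 2)).mul (E_deriv hF hm R0 m0)
  refine h.congr_deriv ?_
  simp only [Pi.pow_apply, show 2 * k + 2 - 1 = 2 * k + 1 from rfl]
  push_cast
  field_simp
  ring

/-- the Erbe–Tang functional along a branch `R` with `u'(R s) = - m s` -/
noncomputable def Pd (k : ℕ) (f R m : ℝ → ℝ) (s : ℝ) : ℝ :=
  2 * (k + 2) * (Fint f s / f s) * (R s ^ (k + 1) * m s) - R s ^ (k + 2) * m s ^ 2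
    - 2 * R s ^ (k + 2) * Fint f s

lemma Pd_deriv {k : ℕ} {f R m : ℝ → ℝ} {s d : ℝ} (hR : HasDerivAt R (-(1 / m s)) s)
    (hF : HasDerivAt (Fint f) (f s) s)
    (hm : HasDerivAt m ((k + 1) / R s - f s / m s) s) (R0 : R s ≠ 0) (m0 : m s ≠ 0)
    (f0 : f s ≠ 0) (hd : HasDerivAt (fun t => Fint f t / f t) d s) :
    HasDerivAt (Pd k f R m) (R s ^ (k + 1) * m s * (2 * (k + 2) * d - k)) s := by
  have h := (((hd.const_mul (2 * ((k:ℝ) + 2))).mul (w_deriv hR hm R0 m0)).sub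
    ((hR.pow (k + 2)).mul (hm.pow 2))).sub (((hR.pow (k + 2)).const_mul 2).mul hF)
  refine h.congr_deriv ?_
  simp only [Pi.pow_apply, show k + 2 - 1 = k + 1 from rfl]
  push_cast
  field_simp
  ring

lemma Pd_cont {k : ℕ} {f R m : ℝ → ℝ} {l t β B : ℝ} (hF : FD k f β B) (hl : B < l)
    (hR : ContinuousOn R (Icc l t)) (hm : ContinuousOn m (Icc l t)) :
    ContinuousOn (Pd k f R m) (Icc l t) := by
  have hs : Icc l t ⊆ Ici 0 := fun s hs => (hF.B_pos.trans hl).le.trans hs.1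
  have h1 := hF.F_cont.mono hs
  have h2 := hF.cont.mono hs
  have h3 : ∀ s ∈ Icc l t, f s ≠ 0 := fun s hs => (hF.f_pos s (hl.trans_le hs.1)).ne'
  unfold Pd
  exact (((continuousOn_const.mul (h1.div h2 h3)).mul ((hR.pow _).mul hm)).sub
    ((hR.pow _).mul (hm.pow 2))).sub ((continuousOn_const.mul (hR.pow _)).mul h1)

/-- choice of the derivative of `F/f` -/
lemma FD.choose_d {k : ℕ} {f : ℝ → ℝ} {β B : ℝ} (hF : FD k f β B) :
    ∃ κ : ℝ → ℝ, ∀ s, β < s → ∃ d, HasDerivAt (fun t => Fint f t / f t) d s ∧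
      κ s = 2 * (k + 2) * d - k ∧ 0 ≤ κ s := by
  choose! d hd using hF.f3
  exact ⟨fun s => 2 * (k + 2) * d s - k, fun s hs => ⟨d s, (hd s hs).2, rfl, by
    have := (hd s hs).1
    simp only
    linarith⟩⟩

/-- derivative data of the increasing branch, in the form used for the decreasing one -/
lemma Br.inc {k : ℕ} {a b β : ℝ} {f u u' : ℝ → ℝ} {c M : ℝ} {r p R m : ℝ → ℝ}
    (h : Br k a b β f u u' c M r p R m) {s : ℝ} (hs : s ∈ Ioo 0 M) :
    HasDerivAt r (-(1 / (fun t => - p t) s)) s ∧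
    HasDerivAt (fun t => - p t) ((k + 1) / r s - f s / (fun t => - p t) s) s ∧ r s ≠ 0 ∧
    (fun t => - p t) s ≠ 0 := by
  have hp := h.p_pos s ⟨hs.1.le, hs.2⟩
  have hr := h.r_pos s ⟨hs.1.le, hs.2.le⟩
  refine ⟨(h.r_deriv s hs).congr_deriv ?_, (h.p_deriv s hs).neg.congr_deriv ?_, hr.ne', ?_⟩
  · simp only; field_simp
  · simp only; field_simp; ring
  · simp only; exact (neg_neg_of_pos hp).ne

lemma Br.dec {k : ℕ} {a b β : ℝ} {f u u' : ℝ → ℝ} {c M : ℝ} {r p R m : ℝ → ℝ}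
    (h : Br k a b β f u u' c M r p R m) {s : ℝ} (hs : s ∈ Ioo 0 M) :
    HasDerivAt R (-(1 / m s)) s ∧
    HasDerivAt m ((k + 1) / R s - f s / m s) s ∧ R s ≠ 0 ∧ m s ≠ 0 :=
  ⟨h.R_deriv s hs, h.m_deriv s hs, (h.R_pos s ⟨hs.1.le, hs.2.le⟩).ne', (h.m_pos s hs).ne'⟩


lemma Br.inc_energy {k : ℕ} {a b β B : ℝ} {f u u' : ℝ → ℝ} {c M : ℝ} {r p R m : ℝ → ℝ}
    (hF : FD k f β B) (h : Br k a b β f u u' c M r p R m) {s : ℝ} (hs : s ∈ Icc 0 M) :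
    0 < p s ^ 2 + 2 * Fint f s := by
  have hsub : Icc s M ⊆ Icc 0 M := Icc_subset_Icc_left hs.1
  have hsub' : Ioo s M ⊆ Ioo 0 M := Ioo_subset_Ioo_left hs.1
  have := anti_of (g := fun t => (- p t) ^ 2 + 2 * Fint f t)
    (g' := fun s => 2 * (k + 1) * (- p s) / r s) hs.2
    (((h.p_cont.mono hsub).neg.pow 2).add (continuousOn_const.mul
      (hF.F_cont.mono (fun t ht => hs.1.trans ht.1)))) ?_ ?_
  · simp only [h.pM] at this
    have h2 := hF.F_pos M h.hM
    nlinarith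
  · intro t ht
    obtain ⟨-, h2, h3, h4⟩ := h.inc (hsub' ht)
    exact E_deriv (hF.F_deriv t (hsub' ht).1) h2 h3 h4
  · intro t ht
    have h1 := h.p_pos t ⟨(hsub' ht).1.le, ht.2⟩
    have h2 := h.r_pos t ⟨(hsub' ht).1.le, ht.2.le⟩
    have : 0 ≤ 2 * (k + 1) * p t / r t := by positivity
    have e : 2 * ((k:ℝ) + 1) * (- p t) / r t = - (2 * (k + 1) * p t / r t) := by ring
    rw [e]; linarith

lemma r_comp {k : ℕ} {a b β : ℝ} {f u₁ u₁' u₂ u₂' : ℝ → ℝ}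
    {c₁ M₁ c₂ M₂ : ℝ} {r₁ p₁ R₁ m₁ r₂ p₂ R₂ m₂ : ℝ → ℝ}
    (h₁ : Br k a b β f u₁ u₁' c₁ M₁ r₁ p₁ R₁ m₁)
    (h₂ : Br k a b β f u₂ u₂' c₂ M₂ r₂ p₂ R₂ m₂) {x : ℝ} (x1 : x ≤ M₁) (x2 : x ≤ M₂)
    (hp : ∀ s ∈ Ico 0 x, p₁ s < p₂ s) : ∀ s ∈ Icc 0 x, r₂ s ≤ r₁ s := by
  intro s hs
  have s1 : Icc 0 s ⊆ Icc 0 M₁ := Icc_subset_Icc_right (hs.2.trans x1)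
  have s2 : Icc 0 s ⊆ Icc 0 M₂ := Icc_subset_Icc_right (hs.2.trans x2)
  have := mono_of (g := fun t => r₁ t - r₂ t) (g' := fun t => 1 / p₁ t - 1 / p₂ t) hs.1
    ((h₁.r_cont.mono s1).sub (h₂.r_cont.mono s2)) ?_ ?_
  · simp only [h₁.r0, h₂.r0] at this
    linarith
  · intro t ht
    exact (h₁.r_deriv t ⟨ht.1, ht.2.trans_le (hs.2.trans x1)⟩).sub
      (h₂.r_deriv t ⟨ht.1, ht.2.trans_le (hs.2.trans x2)⟩)
  · intro t ht
    have := hp t ⟨ht.1.le, ht.2.trans_le hs.2⟩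
    have h0 := h₁.p_pos t ⟨ht.1.le, ht.2.trans_le (hs.2.trans x1)⟩
    have := one_div_le_one_div_of_le h0 this.le
    linarith

lemma inc_one {k : ℕ} {a b β B : ℝ} {f u₁ u₁' u₂ u₂' : ℝ → ℝ} (hF : FD k f β B)
    (ha : 0 < a) {c₁ M₁ c₂ M₂ : ℝ} {r₁ p₁ R₁ m₁ r₂ p₂ R₂ m₂ : ℝ → ℝ}
    (h₁ : Br k a b β f u₁ u₁' c₁ M₁ r₁ p₁ R₁ m₁)
    (h₂ : Br k a b β f u₂ u₂' c₂ M₂ r₂ p₂ R₂ m₂) (hp : p₁ 0 < p₂ 0) :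
    (∀ s ∈ Icc 0 β, p₁ s < p₂ s) ∧
      r₁ β ^ (2 * k + 2) * p₁ β ^ 2 < r₂ β ^ (2 * k + 2) * p₂ β ^ 2 := by
  have hβ : 0 < β := hF.B_pos.trans hF.B_lt
  have key : ∀ x ∈ Icc 0 β, (∀ s ∈ Ico 0 x, p₁ s < p₂ s) →
      r₁ x ^ (2 * k + 2) * (p₁ x ^ 2 + 2 * Fint f x) <
        r₂ x ^ (2 * k + 2) * (p₂ x ^ 2 + 2 * Fint f x) := by
    intro x hx hlt
    have x1 : x < M₁ := hx.2.trans_lt h₁.hM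
    have x2 : x < M₂ := hx.2.trans_lt h₂.hM
    have hr := r_comp h₁ h₂ x1.le x2.le hlt
    have s1 : Icc 0 x ⊆ Icc 0 M₁ := Icc_subset_Icc_right x1.le
    have s2 : Icc 0 x ⊆ Icc 0 M₂ := Icc_subset_Icc_right x2.le
    have hFc : ContinuousOn (Fint f) (Icc 0 x) := hF.F_cont.mono (fun t ht => ht.1)
    have := anti_of (g := fun t => r₁ t ^ (2 * k + 2) * ((- p₁ t) ^ 2 + 2 * Fint f t) -
        r₂ t ^ (2 * k + 2) * ((- p₂ t) ^ 2 + 2 * Fint f t))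
      (g' := fun s => (-(4 * (k + 1) * r₁ s ^ (2 * k + 1) * Fint f s / (- p₁ s)))
        - (-(4 * (k + 1) * r₂ s ^ (2 * k + 1) * Fint f s / (- p₂ s)))) hx.1 ?_ ?_ ?_
    · simp only [h₁.r0, h₂.r0, hF.F_zero, neg_sq] at this
      have hp1 := h₁.p_pos 0 ⟨le_rfl, hβ.trans h₁.hM⟩
      have h3 : a ^ (2 * k + 2) * p₁ 0 ^ 2 < a ^ (2 * k + 2) * p₂ 0 ^ 2 := by gcongr
      linarith
    · exact (((h₁.r_cont.mono s1).pow _).mul (((h₁.p_cont.mono s1).neg.pow 2).add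
        (continuousOn_const.mul hFc))).sub (((h₂.r_cont.mono s2).pow _).mul
        (((h₂.p_cont.mono s2).neg.pow 2).add (continuousOn_const.mul hFc)))
    · intro s hs
      obtain ⟨a1, a2, a3, a4⟩ := h₁.inc (s := s) ⟨hs.1, hs.2.trans x1⟩
      obtain ⟨b1, b2, b3, b4⟩ := h₂.inc (s := s) ⟨hs.1, hs.2.trans x2⟩
      exact (Z_deriv a1 (hF.F_deriv s hs.1) a2 a3 a4).sub (Z_deriv b1 (hF.F_deriv s hs.1) b2 b3 b4)
    · intro s hs
      have hp1 := h₁.p_pos s ⟨hs.1.le, hs.2.trans x1⟩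
      have hp12 := hlt s ⟨hs.1.le, hs.2⟩
      have hr2 := h₂.r_pos s ⟨hs.1.le, (hs.2.trans x2).le⟩
      have hr12 := hr s ⟨hs.1.le, hs.2.le⟩
      have hr1 := hr2.trans_le hr12
      have hFn := hF.F_neg s ⟨hs.1, hs.2.trans_le hx.2⟩
      have h3 : r₂ s ^ (2 * k + 1) / p₂ s ≤ r₁ s ^ (2 * k + 1) / p₁ s := by gcongr
      have h4 : 0 ≤ 4 * ((k:ℝ) + 1) * (-Fint f s) := by
        have : 0 < -Fint f s := by linarith
        positivity
      have h5 := mul_le_mul_of_nonneg_left h3 h4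
      have e : (-(4 * ((k:ℝ) + 1) * r₁ s ^ (2 * k + 1) * Fint f s / (- p₁ s)))
        - (-(4 * (k + 1) * r₂ s ^ (2 * k + 1) * Fint f s / (- p₂ s))) =
        4 * ((k:ℝ) + 1) * (-Fint f s) * (r₂ s ^ (2 * k + 1) / p₂ s) -
        4 * ((k:ℝ) + 1) * (-Fint f s) * (r₁ s ^ (2 * k + 1) / p₁ s) := by
        rw [div_neg, div_neg]; ring
      rw [e]; linarith
  have hmain : ∀ s ∈ Icc 0 β, p₁ s - p₂ s < 0 := by
    apply neg_up
    · exact (h₁.p_cont.mono (Icc_subset_Icc_right h₁.hM.le)).sub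
        (h₂.p_cont.mono (Icc_subset_Icc_right h₂.hM.le))
    · linarith
    · intro x hx hlt h0
      have x1 : x < M₁ := hx.2.trans_lt h₁.hM
      have x2 : x < M₂ := hx.2.trans_lt h₂.hM
      have hlt' : ∀ s ∈ Ico 0 x, p₁ s < p₂ s := fun s hs => by have := hlt s hs; linarith
      have h1 := key x ⟨hx.1.le, hx.2⟩ hlt'
      have h2 := r_comp h₁ h₂ x1.le x2.le hlt' x ⟨hx.1.le, le_rfl⟩
      have h3 : p₁ x = p₂ x := by linarith
      have h4 := h₂.inc_energy hF (s := x) ⟨hx.1.le, x2.le⟩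
      have h5 := h₂.r_pos x ⟨hx.1.le, x2.le⟩
      rw [h3] at h1
      have : r₂ x ^ (2 * k + 2) ≤ r₁ x ^ (2 * k + 2) := by gcongr
      have := mul_le_mul_of_nonneg_right this h4.le
      linarith
  refine ⟨fun s hs => by have := hmain s hs; linarith, ?_⟩
  have := key β ⟨hβ.le, le_rfl⟩ (fun s hs => by have := hmain s ⟨hs.1, hs.2.le⟩; linarith)
  simpa [hF.F_beta] using this

lemma inc_main {k : ℕ} {a b β B : ℝ} {f u₁ u₁' u₂ u₂' : ℝ → ℝ} (hF : FD k f β B)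
    (ha : 0 < a) {c₁ M₁ c₂ M₂ : ℝ} {r₁ p₁ R₁ m₁ r₂ p₂ R₂ m₂ : ℝ → ℝ}
    (h₁ : Br k a b β f u₁ u₁' c₁ M₁ r₁ p₁ R₁ m₁)
    (h₂ : Br k a b β f u₂ u₂' c₂ M₂ r₂ p₂ R₂ m₂) (hp : p₁ 0 < p₂ 0) :
    M₁ < M₂ ∧ (∀ s ∈ Icc 0 M₁, r₂ s ≤ r₁ s) ∧
      ∀ s ∈ Icc β M₁, r₁ s ^ (k + 1) * p₁ s < r₂ s ^ (k + 1) * p₂ s := by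
  have hβ : 0 < β := hF.B_pos.trans hF.B_lt
  obtain ⟨i1, i2⟩ := inc_one hF ha h₁ h₂ hp
  set N := min M₁ M₂ with hN
  have N1 : N ≤ M₁ := min_le_left _ _
  have N2 : N ≤ M₂ := min_le_right _ _
  have hβN : β < N := lt_min h₁.hM h₂.hM
  have key : ∀ x ∈ Icc β N, (∀ s ∈ Ico β x, p₁ s < p₂ s) →
      (r₁ x ^ (k + 1) * p₁ x) ^ 2 < (r₂ x ^ (k + 1) * p₂ x) ^ 2 := by
    intro x hx hlt
    have x1 : x ≤ M₁ := hx.2.trans N1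
    have x2 : x ≤ M₂ := hx.2.trans N2
    have hlt' : ∀ s ∈ Ico 0 x, p₁ s < p₂ s := by
      intro s hs
      rcases lt_or_ge s β with h | h
      · exact i1 s ⟨hs.1, h.le⟩
      · exact hlt s ⟨h, hs.2⟩
    have hr := r_comp h₁ h₂ x1 x2 hlt'
    have s1 : Icc β x ⊆ Icc 0 M₁ := Icc_subset_Icc hβ.le x1
    have s2 : Icc β x ⊆ Icc 0 M₂ := Icc_subset_Icc hβ.le x2
    have := anti_of (g := fun t => (r₁ t ^ (k + 1) * (- p₁ t)) ^ 2 -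
        (r₂ t ^ (k + 1) * (- p₂ t)) ^ 2)
      (g' := fun s => (-(2 * (r₁ s ^ (k + 1)) ^ 2 * f s)) - (-(2 * (r₂ s ^ (k + 1)) ^ 2 * f s)))
      hx.1 ?_ ?_ ?_
    · have e : ∀ r p : ℝ, (r ^ (k + 1) * p) ^ 2 = r ^ (2 * k + 2) * p ^ 2 := by
        intro r p; ring
      simp only [e, neg_sq] at this ⊢
      linarith
    · exact ((((h₁.r_cont.mono s1).pow _).mul (h₁.p_cont.mono s1).neg).pow 2).sub
        ((((h₂.r_cont.mono s2).pow _).mul (h₂.p_cont.mono s2).neg).pow 2)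
    · intro s hs
      obtain ⟨a1, a2, a3, a4⟩ := h₁.inc (s := s) ⟨hβ.trans hs.1, hs.2.trans_le x1⟩
      obtain ⟨b1, b2, b3, b4⟩ := h₂.inc (s := s) ⟨hβ.trans hs.1, hs.2.trans_le x2⟩
      exact (wsq_deriv a1 a2 a3 a4).sub (wsq_deriv b1 b2 b3 b4)
    · intro s hs
      have hr2 := h₂.r_pos s ⟨(hβ.trans hs.1).le, (hs.2.trans_le x2).le⟩
      have hr12 := hr s ⟨(hβ.trans hs.1).le, hs.2.le⟩
      have hf := hF.f_pos s (hF.B_lt.trans hs.1)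
      have h3 : (r₂ s ^ (k + 1)) ^ 2 ≤ (r₁ s ^ (k + 1)) ^ 2 := by gcongr
      have := mul_le_mul_of_nonneg_right h3 hf.le
      linarith
  have hmain : ∀ s ∈ Icc β N, p₁ s - p₂ s < 0 := by
    apply neg_up
    · exact (h₁.p_cont.mono (Icc_subset_Icc hβ.le N1)).sub
        (h₂.p_cont.mono (Icc_subset_Icc hβ.le N2))
    · have := i1 β ⟨hβ.le, le_rfl⟩
      linarith
    · intro x hx hlt h0
      have x1 : x ≤ M₁ := hx.2.trans N1
      have x2 : x ≤ M₂ := hx.2.trans N2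
      have x0 : 0 ≤ x := hβ.le.trans hx.1.le
      have hlt' : ∀ s ∈ Ico 0 x, p₁ s < p₂ s := by
        intro s hs
        rcases lt_or_ge s β with h | h
        · exact i1 s ⟨hs.1, h.le⟩
        · have := hlt s ⟨h, hs.2⟩
          linarith
      have h1 := key x ⟨hx.1.le, hx.2⟩ (fun s hs => hlt' s ⟨hβ.le.trans hs.1, hs.2⟩)
      have h2 := r_comp h₁ h₂ x1 x2 hlt' x ⟨x0, le_rfl⟩
      have h3 : p₁ x = p₂ x := by linarith
      have h5 := h₂.r_pos x ⟨x0, x2⟩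
      rw [h3, mul_pow, mul_pow] at h1
      have : (r₂ x ^ (k + 1)) ^ 2 ≤ (r₁ x ^ (k + 1)) ^ 2 := by gcongr
      have := mul_le_mul_of_nonneg_right this (sq_nonneg (p₂ x))
      linarith
  have hM : M₁ < M₂ := by
    by_contra hcon
    push Not at hcon
    have hNe : N = M₂ := min_eq_right hcon
    have := hmain N ⟨hβN.le, le_rfl⟩
    rw [hNe, h₂.pM] at this
    rcases lt_or_eq_of_le hcon with h | h
    · have := h₁.p_pos M₂ ⟨(hβ.trans h₂.hM).le, h⟩
      linarith
    · rw [h, h₁.pM] at this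
      linarith
  have hNe : N = M₁ := min_eq_left hM.le
  rw [hNe] at hmain key
  refine ⟨hM, ?_, ?_⟩
  · apply r_comp h₁ h₂ le_rfl hM.le
    intro s hs
    rcases lt_or_ge s β with h | h
    · exact i1 s ⟨hs.1, h.le⟩
    · have := hmain s ⟨h, hs.2.le⟩
      linarith
  · intro s hs
    have h1 := key s hs (fun t ht => by have := hmain t ⟨ht.1, ht.2.le.trans hs.2⟩; linarith)
    have s0 : 0 ≤ s := hβ.le.trans hs.1
    have hr2 := h₂.r_pos s ⟨s0, hs.2.trans hM.le⟩
    have hp2 := h₂.p_pos s ⟨s0, hs.2.trans_lt hM⟩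
    exact lt_of_pow_lt_pow_left₀ 2 (by positivity) h1

/-! ### The functional `P` -/

lemma Br.P_dec {k : ℕ} {a b β B : ℝ} {f u u' : ℝ → ℝ} {c M : ℝ} {r p R m : ℝ → ℝ}
    (hF : FD k f β B) (h : Br k a b β f u u' c M r p R m) {s t : ℝ} (hs : β ≤ s) (hst : s ≤ t)
    (ht : t ≤ M) : Pd k f R m s ≤ Pd k f R m t := by
  have hβ : 0 < β := hF.B_pos.trans hF.B_lt
  obtain ⟨κ, hκ⟩ := hF.choose_d
  have hsub : Icc s t ⊆ Icc 0 M := Icc_subset_Icc (hβ.le.trans hs) ht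
  refine mono_of (g' := fun s => R s ^ (k + 1) * m s * κ s) hst
    (Pd_cont hF (hF.B_lt.trans_le hs) (h.R_cont.mono hsub) (h.m_cont.mono hsub)) ?_ ?_
  · intro x hx
    have hx0 : x ∈ Ioo 0 M := ⟨hβ.trans_le (hs.trans hx.1.le), hx.2.trans_le ht⟩
    obtain ⟨a1, a2, a3, a4⟩ := h.dec hx0
    obtain ⟨d, d1, d2, d3⟩ := hκ x (hs.trans_lt hx.1)
    simp only [d2]
    exact Pd_deriv a1 (hF.F_deriv x hx0.1) a2 a3 a4
      (hF.f_pos x (hF.B_lt.trans (hs.trans_lt hx.1))).ne' d1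
  · intro x hx
    have hx0 : x ∈ Ioo 0 M := ⟨hβ.trans_le (hs.trans hx.1.le), hx.2.trans_le ht⟩
    obtain ⟨d, d1, d2, d3⟩ := hκ x (hs.trans_lt hx.1)
    have h1 := h.R_pos x ⟨hx0.1.le, hx0.2.le⟩
    have h2 := h.m_pos x hx0
    positivity

lemma Br.P_inc {k : ℕ} {a b β B : ℝ} {f u u' : ℝ → ℝ} {c M : ℝ} {r p R m : ℝ → ℝ}
    (hF : FD k f β B) (h : Br k a b β f u u' c M r p R m) {s t : ℝ} (hs : β ≤ s) (hst : s ≤ t)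
    (ht : t ≤ M) : Pd k f r (fun t => - p t) t ≤ Pd k f r (fun t => - p t) s := by
  have hβ : 0 < β := hF.B_pos.trans hF.B_lt
  obtain ⟨κ, hκ⟩ := hF.choose_d
  have hsub : Icc s t ⊆ Icc 0 M := Icc_subset_Icc (hβ.le.trans hs) ht
  refine anti_of (g' := fun s => r s ^ (k + 1) * (- p s) * κ s) hst
    (Pd_cont hF (hF.B_lt.trans_le hs) (h.r_cont.mono hsub) (h.p_cont.mono hsub).neg) ?_ ?_
  · intro x hx
    have hx0 : x ∈ Ioo 0 M := ⟨hβ.trans_le (hs.trans hx.1.le), hx.2.trans_le ht⟩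
    obtain ⟨a1, a2, a3, a4⟩ := h.inc hx0
    obtain ⟨d, d1, d2, d3⟩ := hκ x (hs.trans_lt hx.1)
    simp only [d2]
    exact Pd_deriv a1 (hF.F_deriv x hx0.1) a2 a3 a4
      (hF.f_pos x (hF.B_lt.trans (hs.trans_lt hx.1))).ne' d1
  · intro x hx
    have hx0 : x ∈ Ioo 0 M := ⟨hβ.trans_le (hs.trans hx.1.le), hx.2.trans_le ht⟩
    obtain ⟨d, d1, d2, d3⟩ := hκ x (hs.trans_lt hx.1)
    have h1 := h.r_pos x ⟨hx0.1.le, hx0.2.le⟩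
    have h2 := h.p_pos x ⟨hx0.1.le, hx0.2⟩
    have : 0 ≤ r x ^ (k + 1) * p x * κ x := by positivity
    linarith

lemma Br.P_top {k : ℕ} {a b β : ℝ} {f u u' : ℝ → ℝ} {c M : ℝ} {r p R m : ℝ → ℝ}
    (h : Br k a b β f u u' c M r p R m) :
    Pd k f r (fun t => - p t) M = Pd k f R m M := by
  simp [Pd, h.rM, h.RM, h.pM, h.mM]

lemma Br.P_nonpos {k : ℕ} {a b β B : ℝ} {f u u' : ℝ → ℝ} {c M : ℝ} {r p R m : ℝ → ℝ}
    (hF : FD k f β B) (h : Br k a b β f u u' c M r p R m) {s : ℝ} (hs : s ∈ Icc β M) :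
    Pd k f R m s ≤ 0 := by
  have h1 := h.P_dec hF hs.1 hs.2 le_rfl
  have h2 : Pd k f R m M ≤ 0 := by
    have h3 := hF.F_pos M h.hM
    have h4 := h.R_pos M ⟨((hF.B_pos.trans hF.B_lt).trans h.hM).le, le_rfl⟩
    have : 0 ≤ 2 * R M ^ (k + 2) * Fint f M := by positivity
    simp only [Pd, h.mM]
    linarith
  linarith

lemma P_max {k : ℕ} {a b β B : ℝ} {f u₁ u₁' u₂ u₂' : ℝ → ℝ} (hF : FD k f β B)
    (ha : 0 < a) {c₁ M₁ c₂ M₂ : ℝ} {r₁ p₁ R₁ m₁ r₂ p₂ R₂ m₂ : ℝ → ℝ}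
    (h₁ : Br k a b β f u₁ u₁' c₁ M₁ r₁ p₁ R₁ m₁)
    (h₂ : Br k a b β f u₂ u₂' c₂ M₂ r₂ p₂ R₂ m₂) (hp : p₁ 0 < p₂ 0) :
    Pd k f R₂ m₂ M₁ < Pd k f R₁ m₁ M₁ := by
  have hβ : 0 < β := hF.B_pos.trans hF.B_lt
  obtain ⟨hM, hr, hw⟩ := inc_main hF ha h₁ h₂ hp
  obtain ⟨κ, hκ⟩ := hF.choose_d
  have hβM := h₁.hM
  have e1 := h₂.P_inc hF hβM.le hM.le le_rfl
  have e2 := h₂.P_dec hF hβM.le hM.le le_rfl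
  rw [← h₁.P_top]
  rw [h₂.P_top] at e1
  have e3 : Pd k f r₂ (fun t => - p₂ t) M₁ < Pd k f r₁ (fun t => - p₁ t) M₁ := by
    have s1 : Icc β M₁ ⊆ Icc 0 M₁ := Icc_subset_Icc_left hβ.le
    have s2 : Icc β M₁ ⊆ Icc 0 M₂ := Icc_subset_Icc hβ.le hM.le
    have := mono_of (g := fun s => Pd k f r₁ (fun t => - p₁ t) s - Pd k f r₂ (fun t => - p₂ t) s)
      (g' := fun s => r₁ s ^ (k + 1) * (- p₁ s) * κ s - r₂ s ^ (k + 1) * (- p₂ s) * κ s) hβM.le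
      ((Pd_cont hF hF.B_lt (h₁.r_cont.mono s1) (h₁.p_cont.mono s1).neg).sub
        (Pd_cont hF hF.B_lt (h₂.r_cont.mono s2) (h₂.p_cont.mono s2).neg)) ?_ ?_
    · have hb : Pd k f r₂ (fun t => - p₂ t) β < Pd k f r₁ (fun t => - p₁ t) β := by
        simp only [Pd, hF.F_beta]
        have hw' := hw β ⟨le_rfl, hβM.le⟩
        have hr' := hr β ⟨hβ.le, hβM.le⟩
        have g1 := h₂.r_pos β ⟨hβ.le, h₂.hM.le⟩
        have g1' := h₁.r_pos β ⟨hβ.le, h₁.hM.le⟩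
        have g2 := h₁.p_pos β ⟨hβ.le, hβM⟩
        have g3 := h₂.p_pos β ⟨hβ.le, h₂.hM⟩
        have g4 : r₁ β * p₁ β < r₂ β * p₂ β := by
          by_contra hcon
          push Not at hcon
          have q1 : r₂ β ^ k ≤ r₁ β ^ k := by gcongr
          have q2 : r₂ β ^ k * (r₂ β * p₂ β) ≤ r₁ β ^ k * (r₁ β * p₁ β) := by gcongr
          have q3 : ∀ x y : ℝ, x ^ k * (x * y) = x ^ (k + 1) * y := by intro x y; ring
          rw [q3, q3] at q2
          linarith
        have g5 : (r₁ β ^ (k + 1) * p₁ β) * (r₁ β * p₁ β) <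
            (r₂ β ^ (k + 1) * p₂ β) * (r₂ β * p₂ β) := by gcongr
        have q3 : ∀ x y : ℝ, (x ^ (k + 1) * y) * (x * y) = x ^ (k + 2) * y ^ 2 := by
          intro x y; ring
        rw [q3, q3] at g5
        simp only [zero_div, mul_zero, zero_mul, neg_sq]
        linarith
      linarith
    · intro x hx
      obtain ⟨a1, a2, a3, a4⟩ := h₁.inc (s := x) ⟨hβ.trans hx.1, hx.2⟩
      obtain ⟨b1, b2, b3, b4⟩ := h₂.inc (s := x) ⟨hβ.trans hx.1, hx.2.trans hM⟩
      obtain ⟨d, d1, d2, d3⟩ := hκ x hx.1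
      have hf0 := (hF.f_pos x (hF.B_lt.trans hx.1)).ne'
      have hFd := hF.F_deriv x (hβ.trans hx.1)
      simp only [d2]
      exact (Pd_deriv a1 hFd a2 a3 a4 hf0 d1).sub (Pd_deriv b1 hFd b2 b3 b4 hf0 d1)
    · intro x hx
      obtain ⟨d, d1, d2, d3⟩ := hκ x hx.1
      have := mul_le_mul_of_nonneg_right (hw x ⟨hx.1.le, hx.2.le⟩).le d3
      linarith
  linarith

/-! ### The decreasing branch below `β` -/

lemma R_scomp {k : ℕ} {a b β : ℝ} {f u₁ u₁' u₂ u₂' : ℝ → ℝ}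
    {c₁ M₁ c₂ M₂ : ℝ} {r₁ p₁ R₁ m₁ r₂ p₂ R₂ m₂ : ℝ → ℝ}
    (h₁ : Br k a b β f u₁ u₁' c₁ M₁ r₁ p₁ R₁ m₁)
    (h₂ : Br k a b β f u₂ u₂' c₂ M₂ r₂ p₂ R₂ m₂) {x t : ℝ} (x0 : 0 ≤ x) (t1 : t ≤ M₁) (t2 : t ≤ M₂)
    (hm : ∀ s ∈ Ioo x t, m₁ s < m₂ s) (hR : R₂ t ≤ R₁ t) : ∀ s ∈ Ico x t, R₂ s < R₁ s := by
  intro s hs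
  have s1 : Icc s t ⊆ Icc 0 M₁ := Icc_subset_Icc (x0.trans hs.1) t1
  have s2 : Icc s t ⊆ Icc 0 M₂ := Icc_subset_Icc (x0.trans hs.1) t2
  have := santi_of (g := fun t => R₁ t - R₂ t) (g' := fun t => -(1 / m₁ t) - (-(1 / m₂ t))) hs.2
    ((h₁.R_cont.mono s1).sub (h₂.R_cont.mono s2)) ?_ ?_
  · linarith
  · intro y hy
    have y0 : 0 < y := (x0.trans hs.1).trans_lt hy.1
    exact (h₁.R_deriv y ⟨y0, hy.2.trans_le t1⟩).sub (h₂.R_deriv y ⟨y0, hy.2.trans_le t2⟩)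
  · intro y hy
    have y0 : 0 < y := (x0.trans hs.1).trans_lt hy.1
    have := hm y ⟨hs.1.trans_lt hy.1, hy.2⟩
    have h0 := h₁.m_pos y ⟨y0, hy.2.trans_le t1⟩
    have := one_div_lt_one_div_of_lt h0 this
    linarith

lemma R_comp {k : ℕ} {a b β : ℝ} {f u₁ u₁' u₂ u₂' : ℝ → ℝ}
    {c₁ M₁ c₂ M₂ : ℝ} {r₁ p₁ R₁ m₁ r₂ p₂ R₂ m₂ : ℝ → ℝ}
    (h₁ : Br k a b β f u₁ u₁' c₁ M₁ r₁ p₁ R₁ m₁)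
    (h₂ : Br k a b β f u₂ u₂' c₂ M₂ r₂ p₂ R₂ m₂) {x t : ℝ} (x0 : 0 ≤ x) (t1 : t ≤ M₁) (t2 : t ≤ M₂)
    (hm : ∀ s ∈ Ioo x t, m₁ s < m₂ s) (hR : R₂ t ≤ R₁ t) : ∀ s ∈ Icc x t, R₂ s ≤ R₁ s := by
  intro s hs
  rcases eq_or_lt_of_le hs.2 with h | h
  · rwa [h]
  · exact (R_scomp h₁ h₂ x0 t1 t2 hm hR s ⟨hs.1, h⟩).le

lemma W_deriv {k : ℕ} {f R m : ℝ → ℝ} {s : ℝ} (hR : HasDerivAt R (-(1 / m s)) s)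
    (hF : HasDerivAt (Fint f) (f s) s)
    (hm : HasDerivAt m ((k + 1) / R s - f s / m s) s) (R0 : R s ≠ 0) (m0 : m s ≠ 0)
    (hE : 0 < m s ^ 2 + 2 * Fint f s) :
    HasDerivAt (fun t => R t * √(m t ^ 2 + 2 * Fint f t))
      ((k * m s + (- 2 * Fint f s) / m s) / √(m s ^ 2 + 2 * Fint f s)) s := by
  have h := hR.mul ((E_deriv hF hm R0 m0).sqrt hE.ne')
  refine h.congr_deriv ?_
  have h1 := Real.sq_sqrt hE.le
  have h2 := Real.sqrt_pos.2 hE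
  set q := √(m s ^ 2 + 2 * Fint f s)
  field_simp
  rw [h1]
  ring

lemma W_alg {k : ℕ} {m₁ m₂ F : ℝ} (h0 : 0 < m₁) (h : m₁ < m₂) (hF : F ≤ 0)
    (hE : 0 < m₁ ^ 2 + 2 * F) :
    (k * m₂ + (- 2 * F) / m₂) / √(m₂ ^ 2 + 2 * F) ≤
      (k * m₁ + (- 2 * F) / m₁) / √(m₁ ^ 2 + 2 * F) := by
  have hE2 : m₁ ^ 2 + 2 * F ≤ m₂ ^ 2 + 2 * F := by gcongr
  have q1 := Real.sqrt_pos.2 hE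
  have q2 := Real.sqrt_le_sqrt hE2
  have q3 := q1.trans_le q2
  have hm2 := h0.trans h
  rw [add_div, add_div]
  have e1 : (- 2 * F) / m₂ / √(m₂ ^ 2 + 2 * F) ≤ (- 2 * F) / m₁ / √(m₁ ^ 2 + 2 * F) := by
    have : 0 ≤ -2 * F := by linarith
    gcongr
  have e2 : k * m₂ / √(m₂ ^ 2 + 2 * F) ≤ k * m₁ / √(m₁ ^ 2 + 2 * F) := by
    rw [div_le_div_iff₀ q3 q1, mul_assoc, mul_assoc]
    apply mul_le_mul_of_nonneg_left _ (Nat.cast_nonneg k)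
    rw [← sq_le_sq₀ (by positivity) (by positivity)]
    rw [mul_pow, mul_pow, Real.sq_sqrt hE.le, Real.sq_sqrt (hE.le.trans hE2)]
    have : m₁ ^ 2 ≤ m₂ ^ 2 := by gcongr
    nlinarith
  linarith

lemma W_lemma {k : ℕ} {a b β B : ℝ} {f u₁ u₁' u₂ u₂' : ℝ → ℝ} (hF : FD k f β B)
    {c₁ M₁ c₂ M₂ : ℝ} {r₁ p₁ R₁ m₁ r₂ p₂ R₂ m₂ : ℝ → ℝ}
    (h₁ : Br k a b β f u₁ u₁' c₁ M₁ r₁ p₁ R₁ m₁)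
    (h₂ : Br k a b β f u₂ u₂' c₂ M₂ r₂ p₂ R₂ m₂) {t : ℝ} (ht : t ∈ Ioc 0 β)
    (hR : R₂ t ≤ R₁ t) (hm : m₁ t < m₂ t)
    (hW : R₁ t * √(m₁ t ^ 2 + 2 * Fint f t) < R₂ t * √(m₂ t ^ 2 + 2 * Fint f t)) : False := by
  have t1 : t < M₁ := ht.2.trans_lt h₁.hM
  have t2 : t < M₂ := ht.2.trans_lt h₂.hM
  have key : ∀ l, 0 < l → ∀ s ∈ Icc l t, m₁ s - m₂ s < 0 := by
    intro l hl
    apply neg_down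
    · exact (h₁.m_cont.mono (Icc_subset_Icc hl.le t1.le)).sub
        (h₂.m_cont.mono (Icc_subset_Icc hl.le t2.le))
    · linarith
    · intro x hx hlt h0
      have x0 : 0 < x := hl.trans_le hx.1
      have hlt' : ∀ s ∈ Ioo x t, m₁ s < m₂ s := fun s hs => by
        have := hlt s ⟨hs.1, hs.2.le⟩
        linarith
      have hRx := R_comp h₁ h₂ x0.le t1.le t2.le hlt' hR x ⟨le_rfl, hx.2.le⟩
      have hmx : m₁ x = m₂ x := by linarith
      have s1 : Icc x t ⊆ Icc 0 M₁ := Icc_subset_Icc x0.le t1.le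
      have s2 : Icc x t ⊆ Icc 0 M₂ := Icc_subset_Icc x0.le t2.le
      have hFc : ContinuousOn (Fint f) (Icc x t) :=
        hF.F_cont.mono (fun s hs => x0.le.trans hs.1)
      have := mono_of (g := fun s => R₁ s * √(m₁ s ^ 2 + 2 * Fint f s) -
          R₂ s * √(m₂ s ^ 2 + 2 * Fint f s))
        (g' := fun s => (k * m₁ s + (- 2 * Fint f s) / m₁ s) / √(m₁ s ^ 2 + 2 * Fint f s) -
          (k * m₂ s + (- 2 * Fint f s) / m₂ s) / √(m₂ s ^ 2 + 2 * Fint f s)) hx.2.le ?_ ?_ ?_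
      · simp only [hmx] at this
        have := mul_le_mul_of_nonneg_right hRx (Real.sqrt_nonneg (m₂ x ^ 2 + 2 * Fint f x))
        linarith
      · exact ((h₁.R_cont.mono s1).mul (((h₁.m_cont.mono s1).pow 2).add
          (continuousOn_const.mul hFc)).sqrt).sub ((h₂.R_cont.mono s2).mul
          (((h₂.m_cont.mono s2).pow 2).add (continuousOn_const.mul hFc)).sqrt)
      · intro s hs
        have i1 : s ∈ Ioo 0 M₁ := ⟨x0.trans hs.1, hs.2.trans t1⟩
        have i2 : s ∈ Ioo 0 M₂ := ⟨x0.trans hs.1, hs.2.trans t2⟩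
        obtain ⟨a1, a2, a3, a4⟩ := h₁.dec i1
        obtain ⟨b1, b2, b3, b4⟩ := h₂.dec i2
        exact (W_deriv a1 (hF.F_deriv s i1.1) a2 a3 a4 (h₁.energy s i1)).sub
          (W_deriv b1 (hF.F_deriv s i1.1) b2 b3 b4 (h₂.energy s i2))
      · intro s hs
        have i1 : s ∈ Ioo 0 M₁ := ⟨x0.trans hs.1, hs.2.trans t1⟩
        have := W_alg (k := k) (h₁.m_pos s i1) (hlt' s hs)
          (hF.F_neg s ⟨i1.1, hs.2.trans_le ht.2⟩).le (h₁.energy s i1)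
        linarith
  have := R_scomp h₁ h₂ le_rfl t1.le t2.le
    (fun s hs => by have := key s hs.1 s ⟨le_rfl, hs.2.le⟩; linarith) hR 0 ⟨le_rfl, ht.1⟩
  rw [h₁.R0, h₂.R0] at this
  exact lt_irrefl _ this

/-! ### The decreasing branch above `β` -/

lemma S_deriv {k : ℕ} {f R₁ m₁ R₂ m₂ : ℝ → ℝ} {s : ℝ} (hR₁ : HasDerivAt R₁ (-(1 / m₁ s)) s)
    (hm₁ : HasDerivAt m₁ ((k + 1) / R₁ s - f s / m₁ s) s) (R₁0 : R₁ s ≠ 0) (m₁0 : m₁ s ≠ 0)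
    (hR₂ : HasDerivAt R₂ (-(1 / m₂ s)) s)
    (hm₂ : HasDerivAt m₂ ((k + 1) / R₂ s - f s / m₂ s) s) (R₂0 : R₂ s ≠ 0) (m₂0 : m₂ s ≠ 0) :
    HasDerivAt (fun t => (R₁ t ^ (k + 1) * m₁ t) / (R₂ t ^ (k + 1) * m₂ t))
      (- ((R₁ s ^ (k + 1) / R₂ s ^ (k + 1)) * f s * ((m₂ s ^ 2 - m₁ s ^ 2) / (m₁ s * m₂ s ^ 3))))
      s := by
  have h := (w_deriv hR₁ hm₁ R₁0 m₁0).div (w_deriv hR₂ hm₂ R₂0 m₂0)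
    (mul_ne_zero (pow_ne_zero _ R₂0) m₂0)
  refine h.congr_deriv ?_
  field_simp
  ring

lemma S_nonpos {k : ℕ} {R₁ m₁ R₂ m₂ f : ℝ} (h1 : 0 < R₁) (h2 : 0 < R₂) (h3 : 0 < m₁)
    (h4 : m₁ ≤ m₂) (h5 : 0 ≤ f) :
    - ((R₁ ^ (k + 1) / R₂ ^ (k + 1)) * f * ((m₂ ^ 2 - m₁ ^ 2) / (m₁ * m₂ ^ 3))) ≤ 0 := by
  have : 0 < m₂ := h3.trans_le h4
  have h6 : 0 ≤ m₂ ^ 2 - m₁ ^ 2 := by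
    have : m₁ ^ 2 ≤ m₂ ^ 2 := by gcongr
    linarith
  have : 0 ≤ (R₁ ^ (k + 1) / R₂ ^ (k + 1)) * f * ((m₂ ^ 2 - m₁ ^ 2) / (m₁ * m₂ ^ 3)) := by
    positivity
  linarith

lemma T_lemma {k : ℕ} {a b β B : ℝ} {f u₁ u₁' u₂ u₂' : ℝ → ℝ} (hF : FD k f β B)
    {c₁ M₁ c₂ M₂ : ℝ} {r₁ p₁ R₁ m₁ r₂ p₂ R₂ m₂ : ℝ → ℝ}
    (h₁ : Br k a b β f u₁ u₁' c₁ M₁ r₁ p₁ R₁ m₁)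
    (h₂ : Br k a b β f u₂ u₂' c₂ M₂ r₂ p₂ R₂ m₂) (hM : M₁ < M₂) {t : ℝ} (ht : t ∈ Ioc β M₁)
    (hR : R₂ t ≤ R₁ t) (hm : m₁ t < m₂ t)
    (hP : Pd k f R₂ m₂ t < Pd k f R₁ m₁ t) : False := by
  have hβ : 0 < β := hF.B_pos.trans hF.B_lt
  obtain ⟨κ, hκ⟩ := hF.choose_d
  have t1 : t ≤ M₁ := ht.2
  have t2 : t < M₂ := ht.2.trans_lt hM
  set C : ℝ := - Pd k f R₂ m₂ t with hC
  have hC0 : 0 ≤ C := by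
    have := h₂.P_nonpos hF (s := t) ⟨ht.1.le, t2.le⟩
    linarith
  set S : ℝ → ℝ := fun s => (R₁ s ^ (k + 1) * m₁ s) / (R₂ s ^ (k + 1) * m₂ s) with hS
  set T : ℝ → ℝ := fun s => Pd k f R₁ m₁ s + C - S s * (Pd k f R₂ m₂ s + C) with hT
  -- `T` is positive as long as `m₁ < m₂`
  have key : ∀ x ∈ Ico β t, (∀ s ∈ Ioo x t, m₁ s < m₂ s) → 0 < T x := by
    intro x hx hlt
    have x0 : 0 < x := hβ.trans_le hx.1
    have s1 : Icc x t ⊆ Icc 0 M₁ := Icc_subset_Icc x0.le t1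
    have s2 : Icc x t ⊆ Icc 0 M₂ := Icc_subset_Icc x0.le t2.le
    have hBx : B < x := hF.B_lt.trans_le hx.1
    have hd : ∀ s ∈ Icc x t, R₂ s ^ (k + 1) * m₂ s ≠ 0 := by
      intro s hs
      have q1 := h₂.R_pos s (s2 hs)
      have q2 := h₂.m_pos s ⟨x0.trans_le hs.1, hs.2.trans_lt t2⟩
      positivity
    have := anti_of (g := T) (g' := fun s => (- (- ((R₁ s ^ (k + 1) / R₂ s ^ (k + 1)) * f s *
        ((m₂ s ^ 2 - m₁ s ^ 2) / (m₁ s * m₂ s ^ 3))))) * (Pd k f R₂ m₂ s + C)) hx.2.le ?_ ?_ ?_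
    · have e : T t = Pd k f R₁ m₁ t - Pd k f R₂ m₂ t := by
        simp only [hT, hC]; ring
      linarith
    · exact ((Pd_cont hF hBx (h₁.R_cont.mono s1) (h₁.m_cont.mono s1)).add continuousOn_const).sub
        (((((h₁.R_cont.mono s1).pow _).mul (h₁.m_cont.mono s1)).div
          (((h₂.R_cont.mono s2).pow _).mul (h₂.m_cont.mono s2)) hd).mul
          ((Pd_cont hF hBx (h₂.R_cont.mono s2) (h₂.m_cont.mono s2)).add continuousOn_const))
    · intro s hs
      have i1 : s ∈ Ioo 0 M₁ := ⟨x0.trans hs.1, hs.2.trans_le t1⟩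
      have i2 : s ∈ Ioo 0 M₂ := ⟨x0.trans hs.1, hs.2.trans t2⟩
      obtain ⟨a1, a2, a3, a4⟩ := h₁.dec i1
      obtain ⟨b1, b2, b3, b4⟩ := h₂.dec i2
      have hFd := hF.F_deriv s i1.1
      have hf0 := (hF.f_pos s (hBx.trans hs.1)).ne'
      obtain ⟨d, d1, d2, d3⟩ := hκ s (hx.1.trans_lt hs.1)
      have hh := ((Pd_deriv a1 hFd a2 a3 a4 hf0 d1).add_const C).sub
        ((S_deriv a1 a2 a3 a4 b1 b2 b3 b4).mul ((Pd_deriv b1 hFd b2 b3 b4 hf0 d1).add_const C))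
      refine hh.congr_deriv ?_
      have hne := hd s ⟨hs.1.le, hs.2.le⟩
      have e : (R₁ s ^ (k + 1) * m₁ s) / (R₂ s ^ (k + 1) * m₂ s) *
        (R₂ s ^ (k + 1) * m₂ s * (2 * (k + 2) * d - k)) =
        R₁ s ^ (k + 1) * m₁ s * (2 * (k + 2) * d - k) := by
        rw [← mul_assoc, div_mul_cancel₀ _ hne]
      rw [e]
      ring
    · intro s hs
      have i1 : s ∈ Ioo 0 M₁ := ⟨x0.trans hs.1, hs.2.trans_le t1⟩
      have i2 : s ∈ Ioo 0 M₂ := ⟨x0.trans hs.1, hs.2.trans t2⟩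
      have q := S_nonpos (k := k) (h₁.R_pos s ⟨i1.1.le, i1.2.le⟩) (h₂.R_pos s ⟨i2.1.le, i2.2.le⟩)
        (h₁.m_pos s i1) (hlt s hs).le (hF.f_pos s (hBx.trans hs.1)).le
      have q2 := h₂.P_dec hF (hx.1.trans hs.1.le) hs.2.le t2.le
      exact mul_nonpos_of_nonneg_of_nonpos (by linarith) (by linarith)
  have hmain : ∀ s ∈ Icc β t, m₁ s - m₂ s < 0 := by
    apply neg_down
    · exact (h₁.m_cont.mono (Icc_subset_Icc hβ.le t1)).sub
        (h₂.m_cont.mono (Icc_subset_Icc hβ.le t2.le))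
    · linarith
    · intro x hx hlt h0
      have x0 : 0 < x := hβ.trans_le hx.1
      have hlt' : ∀ s ∈ Ioo x t, m₁ s < m₂ s := fun s hs => by
        have := hlt s ⟨hs.1, hs.2.le⟩
        linarith
      have i1 : x ∈ Ioo 0 M₁ := ⟨x0, hx.2.trans_le t1⟩
      have i2 : x ∈ Ioo 0 M₂ := ⟨x0, hx.2.trans t2⟩
      have hRx := R_comp h₁ h₂ x0.le t1 t2.le hlt' hR x ⟨le_rfl, hx.2.le⟩
      have hmx : m₁ x = m₂ x := by linarith
      have hTx := key x hx hlt'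
      have g1 := h₂.R_pos x ⟨i2.1.le, i2.2.le⟩
      have g2 := h₂.m_pos x i2
      have g3 := h₂.energy x i2
      have e1 : S x = R₁ x ^ (k + 1) / R₂ x ^ (k + 1) := by
        simp only [hS, hmx]
        rw [mul_div_mul_right _ _ g2.ne']
      have e2 : 1 ≤ S x := by
        rw [e1, one_le_div (by positivity)]
        gcongr
      have e3 : T x = R₁ x ^ (k + 1) * ((m₂ x ^ 2 + 2 * Fint f x) * (R₂ x - R₁ x)) +
          C * (1 - S x) := by
        simp only [hT]
        rw [e1]
        simp only [Pd, hmx]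
        field_simp
        ring
      have g4 := h₁.R_pos x ⟨i1.1.le, i1.2.le⟩
      have e4 : R₁ x ^ (k + 1) * ((m₂ x ^ 2 + 2 * Fint f x) * (R₂ x - R₁ x)) ≤ 0 :=
        mul_nonpos_of_nonneg_of_nonpos (by positivity)
          (mul_nonpos_of_nonneg_of_nonpos g3.le (by linarith))
      have e5 : C * (1 - S x) ≤ 0 := mul_nonpos_of_nonneg_of_nonpos hC0 (by linarith)
      linarith
  have hlt' : ∀ s ∈ Ioo β t, m₁ s < m₂ s := fun s hs => by
    have := hmain s ⟨hs.1.le, hs.2.le⟩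
    linarith
  have hTβ := key β ⟨le_rfl, ht.1⟩ hlt'
  have hRβ := R_comp h₁ h₂ hβ.le t1 t2.le hlt' hR β ⟨le_rfl, ht.1.le⟩
  have hmβ := hmain β ⟨le_rfl, ht.1.le⟩
  have i1 : β ∈ Ioo 0 M₁ := ⟨hβ, h₁.hM⟩
  have i2 : β ∈ Ioo 0 M₂ := ⟨hβ, h₂.hM⟩
  have g1 := h₁.R_pos β ⟨i1.1.le, i1.2.le⟩
  have g2 := h₂.R_pos β ⟨i2.1.le, i2.2.le⟩
  have g3 := h₁.m_pos β i1
  have g4 := h₂.m_pos β i2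
  have hW : R₁ β * m₁ β < R₂ β * m₂ β := by
    by_contra hcon
    push Not at hcon
    have e2 : 1 ≤ S β := by
      simp only [hS]
      rw [one_le_div (by positivity), pow_succ, pow_succ, mul_assoc, mul_assoc]
      gcongr
    have e3 : T β = R₁ β ^ (k + 1) * m₁ β * (R₂ β * m₂ β - R₁ β * m₁ β) +
          C * (1 - S β) := by
      simp only [hT, Pd, hF.F_beta, hS]
      field_simp
      ring
    have e4 : R₁ β ^ (k + 1) * m₁ β * (R₂ β * m₂ β - R₁ β * m₁ β) ≤ 0 :=
      mul_nonpos_of_nonneg_of_nonpos (by positivity) (by linarith)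
    have e5 : C * (1 - S β) ≤ 0 := mul_nonpos_of_nonneg_of_nonpos hC0 (by linarith)
    linarith
  refine W_lemma hF h₁ h₂ (t := β) ⟨hβ, le_rfl⟩ hRβ (by linarith) ?_
  simpa [hF.F_beta, Real.sqrt_sq g3.le, Real.sqrt_sq g4.le] using hW

/-! ### The two solutions must cross on the decreasing branch -/

lemma f4_mono {k : ℕ} {f : ℝ → ℝ} {β B : ℝ} (hF : FD k f β B) {s t : ℝ} (hs : B < s)
    (hst : s ≤ t) : f s * (t - B) ≤ f t * (s - B) := by
  have h1 := mono_of (g := fun x => f x / (x - B))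
    (g' := fun x => (deriv f x * (x - B) - f x * 1) / (x - B) ^ 2) hst ?_ ?_ ?_
  · rw [div_le_div_iff₀ (by linarith) (by linarith)] at h1
    exact h1
  · intro x hx
    have hx0 : 0 < x := hF.B_pos.trans (hs.trans_le hx.1)
    have hxB : x - B ≠ 0 := by have := hx.1; intro h; linarith
    exact ((hF.diff x hx0).continuousAt.div (by fun_prop) hxB).continuousWithinAt
  · intro x hx
    have hx0 : 0 < x := hF.B_pos.trans (hs.trans hx.1)
    have hxB : x - B ≠ 0 := by have := hx.1; intro h; linarith
    exact (hF.diff x hx0).hasDerivAt.div ((hasDerivAt_id x).sub_const B) hxB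
  · intro x hx
    have := hF.f4 x (hs.trans hx.1)
    exact div_nonneg (by linarith) (sq_nonneg _)

lemma cross_lemma {k : ℕ} {a b β B : ℝ} {f u₁ u₁' u₂ u₂' : ℝ → ℝ} (hF : FD k f β B) (ha : 0 < a)
    (hs₁ : IsPosSolAnn (k + 2) a b f u₁ u₁') (hs₂ : IsPosSolAnn (k + 2) a b f u₂ u₂')
    {c₁ M₁ c₂ M₂ : ℝ} {r₁ p₁ R₁ m₁ r₂ p₂ R₂ m₂ : ℝ → ℝ}
    (h₁ : Br k a b β f u₁ u₁' c₁ M₁ r₁ p₁ R₁ m₁)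
    (h₂ : Br k a b β f u₂ u₂' c₂ M₂ r₂ p₂ R₂ m₂) (hM : M₁ < M₂)
    (hr : ∀ s ∈ Icc 0 M₁, r₂ s ≤ r₁ s) (hR : ∀ s ∈ Icc B M₁, R₁ s < R₂ s) : False := by
  obtain ⟨-, -, -, hud₁, hu'd₁, -⟩ := hs₁
  obtain ⟨-, -, -, hud₂, hu'd₂, -⟩ := hs₂
  have e : ((k + 2 : ℕ) : ℝ) - 1 = k + 1 := by push_cast; ring
  rw [e] at hu'd₁ hu'd₂
  have hB := hF.B_pos
  have hBM : B < M₁ := hF.B_lt.trans h₁.hM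
  have iB : B ∈ Ioo 0 M₁ := ⟨hB, hBM⟩
  have iB' : B ∈ Icc 0 M₁ := ⟨hB.le, hBM.le⟩
  have q1 := h₁.r_memo B iB
  have q2 := h₁.R_memo B iB
  have hcc := h₁.hc
  have hlt : r₁ B < R₁ B := q1.2.trans q2.1
  have hin : ∀ x ∈ Icc (r₁ B) (R₁ B), x ∈ Ioo a b := fun x hx =>
    ⟨q1.1.trans_le hx.1, hx.2.trans_lt q2.2⟩
  have hBu : ∀ x ∈ Ioo (r₁ B) (R₁ B), B < u₁ x := fun x hx => h₁.between B iB' x hx.1 hx.2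
  have hle : ∀ x ∈ Icc (r₁ B) (R₁ B), B ≤ u₁ x := by
    intro x hx
    rcases eq_or_lt_of_le hx.1 with h | h
    · rw [← h, h₁.u_r B iB']
    rcases eq_or_lt_of_le hx.2 with h' | h'
    · rw [h', h₁.u_R B iB']
    exact (hBu x ⟨h, h'⟩).le
  have hcmp : ∀ x ∈ Icc (r₁ B) (R₁ B), u₁ x ≤ u₂ x := by
    intro x hx
    have hBx := hle x hx
    have hxab := hin x hx
    have hloc : u₁ x ≤ M₁ ∧ r₁ (u₁ x) ≤ x ∧ x ≤ R₁ (u₁ x) := by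
      rcases le_total x c₁ with h | h
      · obtain ⟨g1, g2⟩ := h₁.cover_r x ⟨hxab.1.le, h⟩
        exact ⟨g1.2, g2.le, h.trans (h₁.R_mem _ g1).1⟩
      · obtain ⟨g1, g2⟩ := h₁.cover_R x ⟨h, hxab.2.le⟩
        exact ⟨g1.2, (h₁.r_mem _ g1).2.trans h, g2.ge⟩
    obtain ⟨g1, g2, g3⟩ := hloc
    have g4 := hr (u₁ x) ⟨hB.le.trans hBx, g1⟩
    have g5 := hR (u₁ x) ⟨hBx, g1⟩
    have i2 : u₁ x ∈ Icc 0 M₂ := ⟨hB.le.trans hBx, g1.trans hM.le⟩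
    rcases eq_or_lt_of_le (g4.trans g2) with h | h
    · have := h₂.u_r _ i2
      rw [h] at this
      exact this.ge
    · exact (h₂.between _ i2 x h (g3.trans_lt g5)).le
  have hmono := mono_of (g := fun x => x ^ (k + 1) * (u₁' x * (u₂ x - B) - (u₁ x - B) * u₂' x))
    (g' := fun x => x ^ (k + 1) * (f (u₂ x) * (u₁ x - B) - f (u₁ x) * (u₂ x - B))) hlt.le ?_ ?_ ?_
  · have hB2 : B < u₂ (R₁ B) := by
      apply h₂.between B ⟨hB.le, (hBM.trans hM).le⟩
      · exact (hr B iB').trans_lt hlt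
      · exact hR B ⟨le_rfl, hBM.le⟩
    have hB3 := hcmp (r₁ B) ⟨le_rfl, hlt.le⟩
    rw [h₁.u_r B iB'] at hB3
    simp only [h₁.u_r B iB', h₁.u_R B iB', h₁.u'_r B iB', h₁.u'_R B iB'] at hmono
    have g1 := h₁.p_pos B ⟨hB.le, hBM⟩
    have g2 := h₁.m_pos B iB
    have g3 := h₁.r_pos B iB'
    have g4 := h₁.R_pos B iB'
    have l1 : 0 ≤ r₁ B ^ (k + 1) * (p₁ B * (u₂ (r₁ B) - B) - (B - B) * u₂' (r₁ B)) := by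
      have : 0 ≤ u₂ (r₁ B) - B := by linarith
      rw [sub_self, zero_mul, sub_zero]
      positivity
    have l2 : 0 < R₁ B ^ (k + 1) * (m₁ B * (u₂ (R₁ B) - B)) := by
      have : 0 < u₂ (R₁ B) - B := by linarith
      positivity
    linarith
  · intro x hx
    have hx' := hin x hx
    have c1 := (hud₁ x hx').continuousAt
    have c2 := (hud₂ x hx').continuousAt
    have c3 := (hu'd₁ x hx').continuousAt
    have c4 := (hu'd₂ x hx').continuousAt
    exact ((continuousAt_id.pow _).mul ((c3.mul (c2.sub continuousAt_const)).sub
      ((c1.sub continuousAt_const).mul c4))).continuousWithinAt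
  · intro x hx
    have hx' := hin x ⟨hx.1.le, hx.2.le⟩
    have hx0 : x ≠ 0 := (ha.trans hx'.1).ne'
    have hh := (hasDerivAt_pow (k + 1) x).mul (((hu'd₁ x hx').mul ((hud₂ x hx').sub_const B)).sub
      (((hud₁ x hx').sub_const B).mul (hu'd₂ x hx')))
    refine hh.congr_deriv ?_
    simp only [Nat.add_sub_cancel, Pi.sub_apply, Pi.mul_apply]
    push_cast
    field_simp
    ring
  · intro x hx
    have hx' := hin x ⟨hx.1.le, hx.2.le⟩
    have hx0 : 0 < x := ha.trans hx'.1
    have := f4_mono hF (hBu x hx) (hcmp x ⟨hx.1.le, hx.2.le⟩)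
    exact mul_nonneg (by positivity) (by linarith)

lemma main_lemma {k : ℕ} {a b β B : ℝ} {f u₁ u₁' u₂ u₂' : ℝ → ℝ} (hF : FD k f β B) (ha : 0 < a)
    (hs₁ : IsPosSolAnn (k + 2) a b f u₁ u₁') (hs₂ : IsPosSolAnn (k + 2) a b f u₂ u₂')
    {c₁ M₁ c₂ M₂ : ℝ} {r₁ p₁ R₁ m₁ r₂ p₂ R₂ m₂ : ℝ → ℝ}
    (h₁ : Br k a b β f u₁ u₁' c₁ M₁ r₁ p₁ R₁ m₁)
    (h₂ : Br k a b β f u₂ u₂' c₂ M₂ r₂ p₂ R₂ m₂) (hp : p₁ 0 < p₂ 0) :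
    ∀ r ∈ Icc a b, u₁ r = u₂ r := by
  have hβ : 0 < β := hF.B_pos.trans hF.B_lt
  have hB := hF.B_pos
  obtain ⟨hM, hr, -⟩ := inc_main hF ha h₁ h₂ hp
  have hP := P_max hF ha h₁ h₂ hp
  have hβM := h₁.hM
  have hM0 : 0 < M₁ := hβ.trans hβM
  have hmM : m₁ M₁ < m₂ M₁ := by
    rw [h₁.mM]
    exact h₂.m_pos M₁ ⟨hM0, hM⟩
  rcases le_or_gt (R₂ M₁) (R₁ M₁) with hc | hc
  · exact (T_lemma hF h₁ h₂ hM ⟨hβM, le_rfl⟩ hc hmM hP).elim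
  by_cases hx : ∃ x ∈ Ico B M₁, (∀ s ∈ Ioc x M₁, R₁ s - R₂ s < 0) ∧ R₁ x - R₂ x = 0
  swap
  · exfalso
    push Not at hx
    have := neg_down (g := fun s => R₁ s - R₂ s) (l := B) (t := M₁)
      ((h₁.R_cont.mono (Icc_subset_Icc_left hB.le)).sub
        (h₂.R_cont.mono (Icc_subset_Icc hB.le hM.le))) (by linarith) hx
    exact cross_lemma hF ha hs₁ hs₂ h₁ h₂ hM hr
      (fun s hs => by have := this s hs; linarith)
  obtain ⟨x, hx, hlt, h0⟩ := hx
  have x0 : 0 < x := hB.trans_le hx.1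
  have i1 : x ∈ Ioo 0 M₁ := ⟨x0, hx.2⟩
  have i2 : x ∈ Ioo 0 M₂ := ⟨x0, hx.2.trans hM⟩
  have hRe : R₁ x = R₂ x := by linarith
  have gR := h₂.R_pos x ⟨i2.1.le, i2.2.le⟩
  have gm1 := h₁.m_pos x i1
  have gm2 := h₂.m_pos x i2
  have hm : ∀ l ∈ Ioc x M₁, ∀ s ∈ Icc l M₁, m₁ s - m₂ s < 0 := by
    intro l hl
    have l0 : 0 < l := x0.trans hl.1
    apply neg_down
    · exact (h₁.m_cont.mono (Icc_subset_Icc_left l0.le)).sub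
        (h₂.m_cont.mono (Icc_subset_Icc l0.le hM.le))
    · linarith
    · intro y hy hneg hy0
      have y0 : 0 < y := l0.trans_le hy.1
      have j1 : y ∈ Ioo 0 M₁ := ⟨y0, hy.2⟩
      have j2 : y ∈ Ioo 0 M₂ := ⟨y0, hy.2.trans hM⟩
      have := deriv_nonpos_of_right hy.2 ((h₁.m_deriv y j1).sub (h₂.m_deriv y j2)) hy0 hneg
      have hye : m₁ y = m₂ y := by linarith
      rw [hye] at this
      have hRy := hlt y ⟨hl.1.trans_le hy.1, hy.2.le⟩
      have gy := h₁.R_pos y ⟨j1.1.le, j1.2.le⟩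
      have : ((k:ℝ) + 1) / R₂ y < (k + 1) / R₁ y :=
        div_lt_div_of_pos_left (by positivity) gy (by linarith)
      linarith
  have hm' : ∀ s ∈ Ioc x M₁, m₁ s < m₂ s := fun s hs => by
    have := hm s hs s ⟨le_rfl, hs.2⟩
    linarith
  have hmx : m₁ x ≤ m₂ x := by
    have := deriv_nonpos_of_right hx.2 ((h₁.R_deriv x i1).sub (h₂.R_deriv x i2)) h0 hlt
    have h3 : 1 / m₂ x ≤ 1 / m₁ x := by linarith
    exact (one_div_le_one_div gm2 gm1).1 h3
  rcases eq_or_lt_of_le hmx with hme | hme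
  · have hxR := h₁.R_memo x i1
    refine uniq_interior hF ha hs₁ hs₂ (x0 := R₁ x) ⟨h₁.hc.1.trans hxR.1, hxR.2⟩ ?_ ?_
    · rw [h₁.u_R x ⟨i1.1.le, i1.2.le⟩, hRe, h₂.u_R x ⟨i2.1.le, i2.2.le⟩]
    · rw [h₁.u'_R x ⟨i1.1.le, i1.2.le⟩, hRe, h₂.u'_R x ⟨i2.1.le, i2.2.le⟩, hme]
  exfalso
  rcases le_or_gt x β with hxβ | hxβ
  · refine W_lemma hF h₁ h₂ ⟨x0, hxβ⟩ hRe.ge hme ?_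
    rw [hRe]
    have e1 := h₁.energy x i1
    have : √(m₁ x ^ 2 + 2 * Fint f x) < √(m₂ x ^ 2 + 2 * Fint f x) := by
      apply Real.sqrt_lt_sqrt e1.le
      gcongr
    gcongr
  · have hw : ∀ y ∈ Icc x M₁, R₁ y ^ (k + 1) * m₁ y ≤ R₂ y ^ (k + 1) * m₂ y := by
      intro y hy
      have s1 : Icc x y ⊆ Icc 0 M₁ := Icc_subset_Icc x0.le hy.2
      have s2 : Icc x y ⊆ Icc 0 M₂ := Icc_subset_Icc x0.le (hy.2.trans hM.le)
      have hd : ∀ s ∈ Icc x y, 0 < R₂ s ^ (k + 1) * m₂ s := by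
        intro s hs
        have q1 := h₂.R_pos s (s2 hs)
        have q2 := h₂.m_pos s ⟨x0.trans_le hs.1, (hs.2.trans hy.2).trans_lt hM⟩
        positivity
      have := anti_of (g := fun t => (R₁ t ^ (k + 1) * m₁ t) / (R₂ t ^ (k + 1) * m₂ t))
        (g' := fun s => - ((R₁ s ^ (k + 1) / R₂ s ^ (k + 1)) * f s *
          ((m₂ s ^ 2 - m₁ s ^ 2) / (m₁ s * m₂ s ^ 3)))) hy.1 ?_ ?_ ?_
      · have e1 : (R₁ x ^ (k + 1) * m₁ x) / (R₂ x ^ (k + 1) * m₂ x) ≤ 1 := by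
          rw [div_le_one (hd x ⟨le_rfl, hy.1⟩), hRe]
          gcongr
        exact (div_le_one (hd y ⟨hy.1, le_rfl⟩)).1 (this.trans e1)
      · exact (((h₁.R_cont.mono s1).pow _).mul (h₁.m_cont.mono s1)).div
          (((h₂.R_cont.mono s2).pow _).mul (h₂.m_cont.mono s2)) (fun s hs => (hd s hs).ne')
      · intro s hs
        obtain ⟨a1, a2, a3, a4⟩ := h₁.dec (s := s) ⟨x0.trans hs.1, hs.2.trans_le hy.2⟩
        obtain ⟨b1, b2, b3, b4⟩ := h₂.dec (s := s) ⟨x0.trans hs.1, (hs.2.trans_le hy.2).trans hM⟩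
        exact S_deriv a1 a2 a3 a4 b1 b2 b3 b4
      · intro s hs
        have j1 : s ∈ Ioo 0 M₁ := ⟨x0.trans hs.1, hs.2.trans_le hy.2⟩
        have j2 : s ∈ Ioo 0 M₂ := ⟨j1.1, j1.2.trans hM⟩
        exact S_nonpos (h₁.R_pos s ⟨j1.1.le, j1.2.le⟩) (h₂.R_pos s ⟨j2.1.le, j2.2.le⟩)
          (h₁.m_pos s j1) (hm' s ⟨hs.1, j1.2.le⟩).le
          (hF.f_pos s (hF.B_lt.trans (hxβ.trans hs.1))).le
    refine T_lemma hF h₁ h₂ hM ⟨hxβ, hx.2.le⟩ hRe.ge hme ?_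
    obtain ⟨κ, hκ⟩ := hF.choose_d
    have s1 : Icc x M₁ ⊆ Icc 0 M₁ := Icc_subset_Icc_left x0.le
    have s2 : Icc x M₁ ⊆ Icc 0 M₂ := Icc_subset_Icc x0.le hM.le
    have hBx := hF.B_lt.trans hxβ
    have := anti_of (g := fun s => Pd k f R₁ m₁ s - Pd k f R₂ m₂ s)
      (g' := fun s => R₁ s ^ (k + 1) * m₁ s * κ s - R₂ s ^ (k + 1) * m₂ s * κ s) hx.2.le
      ((Pd_cont hF hBx (h₁.R_cont.mono s1) (h₁.m_cont.mono s1)).sub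
        (Pd_cont hF hBx (h₂.R_cont.mono s2) (h₂.m_cont.mono s2))) ?_ ?_
    · linarith
    · intro s hs
      obtain ⟨a1, a2, a3, a4⟩ := h₁.dec (s := s) ⟨x0.trans hs.1, hs.2⟩
      obtain ⟨b1, b2, b3, b4⟩ := h₂.dec (s := s) ⟨x0.trans hs.1, hs.2.trans hM⟩
      obtain ⟨d, d1, d2, d3⟩ := hκ s (hxβ.trans hs.1)
      have hf0 := (hF.f_pos s (hBx.trans hs.1)).ne'
      have hFd := hF.F_deriv s (x0.trans hs.1)
      simp only [d2]
      exact (Pd_deriv a1 hFd a2 a3 a4 hf0 d1).sub (Pd_deriv b1 hFd b2 b3 b4 hf0 d1)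
    · intro s hs
      obtain ⟨d, d1, d2, d3⟩ := hκ s (hxβ.trans hs.1)
      have := mul_le_mul_of_nonneg_right (hw s ⟨hs.1.le, hs.2.le⟩) d3
      linarith

end Ann

/-- Theorem 1 (main0): under (f1)–(f4), problem (R) has at most one positive solution
for every `a` and `b` with `0 < a < b < ∞`. -/
theorem uniqueness_annulus
    (n : ℕ) (hn : 2 ≤ n) (f : ℝ → ℝ) (β B : ℝ)
    (hf1 : CondF1 f) (hf2 : CondF2 f β B) (hf3 : CondF3 n f β) (hf4 : CondF4 f β B)
    (a b : ℝ) (ha : 0 < a) (hab : a < b)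
    (u₁ u₁' u₂ u₂' : ℝ → ℝ)
    (h₁ : IsPosSolAnn n a b f u₁ u₁') (h₂ : IsPosSolAnn n a b f u₂ u₂') :
    ∀ r ∈ Icc a b, u₁ r = u₂ r := by
  obtain ⟨k, rfl⟩ : ∃ k, n = k + 2 := ⟨n - 2, by omega⟩
  have hF := Ann.FD_of hf1 hf2 hf3 hf4
  obtain ⟨c₁, M₁, r₁, p₁, R₁, m₁, b₁⟩ := Ann.exists_br hF ha hab h₁
  obtain ⟨c₂, M₂, r₂, p₂, R₂, m₂, b₂⟩ := Ann.exists_br hF ha hab h₂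
  rcases lt_trichotomy (p₁ 0) (p₂ 0) with h | h | h
  · exact Ann.main_lemma hF ha h₁ h₂ b₁ b₂ h
  · obtain ⟨e1, e2⟩ := Ann.uniq_start hF ha b₁ b₂ h
    have hβ : 0 < β := hF.B_pos.trans hF.B_lt
    have i1 := b₁.r_memo β ⟨hβ, b₁.hM⟩
    refine Ann.uniq_interior hF ha h₁ h₂ (x0 := r₁ β) ⟨i1.1, i1.2.trans b₁.hc.2⟩ ?_ ?_
    · rw [b₁.u_r β ⟨hβ.le, b₁.hM.le⟩, e1, b₂.u_r β ⟨hβ.le, b₂.hM.le⟩]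
    · rw [b₁.u'_r β ⟨hβ.le, b₁.hM.le⟩, e1, b₂.u'_r β ⟨hβ.le, b₂.hM.le⟩, e2]
  · exact fun r hr => (Ann.main_lemma hF ha h₂ h₁ b₂ b₁ h r hr).symm
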